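/- arXiv:2407.19230 — 3 statements merged into one kernel-verified Lean document; each statement's English description precedes it below -/
import Mathlib

section
/- Let k and n be nonnegative integers, let p_1, p_2, …, p_{k+1} be prime numbers with p_i ≡ 2 (mod 3) for each i ∈ {1, …, k+1}, and let j be a nonnegative integer with p_{k+1} ∤ j. Then B_{3,7}( p_1² p_2² ⋯ p_k² p_{k+1}² n + ( p_1² p_2² ⋯ p_k² · p_{k+1} (3j + p_{k+1}) − 1 ) / 3 ) ≡ 0 (mod 3). -/
/-- The number of `t`-regular partitions of `n`, i.e. partitions of `n`
none of whose parts is divisible by `t`. -/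
noncomputable def regularPartitionCount (t n : ℕ) : ℕ :=
  Nat.card {π : n.Partition // ∀ x ∈ π.parts, ¬ t ∣ x}

/-- `B u v n` is the number of `(u,v)`-regular bipartitions of `n`: pairs `(α, β)` of
partitions with `|α| + |β| = n`, `α` being `u`-regular and `β` being `v`-regular. -/
noncomputable def B (u v n : ℕ) : ℕ :=
  ∑ i ∈ Finset.range (n + 1), regularPartitionCount u i * regularPartitionCount v (n - i)

open Finset PowerSeries

/-- The generating function of `regularPartitionCount t` over `R`. -/
noncomputable def regularSeries (R : Type*) [CommRing R] (t : ℕ) : R⟦X⟧ :=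
  PowerSeries.mk fun n ↦ (regularPartitionCount t n : R)

theorem regularPartitionCount_eq_card_countRestricted {t : ℕ} (ht : 0 < t) (n : ℕ) :
    regularPartitionCount t n = #(Nat.Partition.countRestricted n t) := by
  rw [← Nat.Partition.card_restricted_eq_card_countRestricted n ht, regularPartitionCount,
    Nat.Partition.restricted, Nat.card_eq_fintype_card, Fintype.card_subtype]

section Series
open PowerSeries.WithPiTopology

variable (R : Type*) [CommRing R]

theorem hasProd_regularSeries [TopologicalSpace R] [T2Space R] {t : ℕ} (ht : 0 < t) :
    HasProd (fun i ↦ ∑ j ∈ range t, X ^ ((i + 1) * j)) (regularSeries R t) := by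
  simpa only [regularSeries, regularPartitionCount_eq_card_countRestricted ht] using
    Nat.Partition.hasProd_powerSeriesMk_card_countRestricted R ht

theorem hasProd_expand_pentagonalSeries [TopologicalSpace R] {t : ℕ} (ht : t ≠ 0) :
    HasProd (fun i ↦ (1 - X ^ (t * (i + 1)) : R⟦X⟧)) (expand t ht (pentagonalSeries R)) := by
  have hc : Continuous (expand (R := R) t ht) := by
    rw [continuous_iff_continuousAt]
    intro f
    rw [ContinuousAt, tendsto_iff_coeff_tendsto]
    intro d
    simp only [coeff_expand]
    split_ifs
    · exact (continuous_coeff R _).continuousAt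
    · exact tendsto_const_nhds
  have := (hasProd_one_sub_X_pow R).map (expand t ht) hc
  simpa [Function.comp_def, ← pow_mul] using this

theorem regularSeries_mul_pentagonalSeries {t : ℕ} (ht : t ≠ 0) :
    regularSeries R t * pentagonalSeries R = expand t ht (pentagonalSeries R) := by
  let : TopologicalSpace R := ⊥
  have : DiscreteTopology R := ⟨rfl⟩
  have h := (hasProd_regularSeries R (Nat.pos_of_ne_zero ht)).mul (hasProd_one_sub_X_pow R)
  refine h.unique ?_
  convert hasProd_expand_pentagonalSeries R ht using 2 with i
  simp_rw [pow_mul, geom_sum_mul_neg]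
  rw [← pow_mul, ← pow_mul, mul_comm]

theorem regularSeries_three : regularSeries (ZMod 3) 3 = pentagonalSeries (ZMod 3) ^ 2 := by
  let : TopologicalSpace (ZMod 3) := ⊥
  have : DiscreteTopology (ZMod 3) := ⟨rfl⟩
  refine (hasProd_regularSeries (ZMod 3) (by norm_num)).unique ?_
  rw [sq]
  convert (hasProd_one_sub_X_pow (ZMod 3)).mul (hasProd_one_sub_X_pow (ZMod 3)) using 2 with i
  have h3 : (3 : (ZMod 3)⟦X⟧) = 0 := by
    have h := congrArg (C (R := ZMod 3)) (show (3 : ZMod 3) = 0 from rfl)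
    rwa [map_zero, map_ofNat] at h
  simp only [sum_range_succ, sum_range_zero, pow_mul]
  linear_combination X ^ (i + 1) * h3

theorem natCast_B_eq_coeff (n : ℕ) :
    (B 3 7 n : ZMod 3) = coeff n (pentagonalSeries (ZMod 3) *
      expand 7 (by norm_num) (pentagonalSeries (ZMod 3))) := by
  rw [← regularSeries_mul_pentagonalSeries (ZMod 3) (by norm_num : 7 ≠ 0), mul_left_comm, ← sq,
    ← regularSeries_three, mul_comm, coeff_mul,
    Nat.sum_antidiagonal_eq_sum_range_succ_mk, B]
  simp [regularSeries]

end Series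

theorem coeff_pentagonalSeries_eq_sum {R : Type*} [CommRing R] {a K : ℕ} (h : a ≤ K) :
    coeff a (pentagonalSeries R) =
      ∑ k ∈ Icc (-K : ℤ) K, if pentagonal k = a then ((k.negOnePow : ℤ) : R) else 0 := by
  by_cases ha : a ∈ Set.range pentagonal
  · obtain ⟨k, rfl⟩ := ha
    rw [coeff_pentagonalSeries_pentagonal, sum_eq_single k]
    · simp
    · intro b _ hb
      simp [hb]
    · intro hk
      have := two_mul_natCast_pentagonal k
      refine absurd ?_ hk
      have h' : (pentagonal k : ℤ) ≤ K := by exact_mod_cast h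
      rw [mem_Icc]
      constructor <;> nlinarith
  · rw [coeff_pentagonalSeries_eq_zero R ha, sum_eq_zero]
    intro k _
    rw [if_neg fun hk ↦ ha ⟨k, hk⟩]

theorem natCast_B_eq_sum (N : ℕ) :
    (B 3 7 N : ZMod 3) = ∑ z ∈ Icc (-N : ℤ) N ×ˢ Icc (-N : ℤ) N with
      pentagonal z.1 + 7 * pentagonal z.2 = N, (((z.1 + z.2).negOnePow : ℤ) : ZMod 3) := by
  have hexp : ∀ b ≤ N, coeff b (expand 7 (by norm_num) (pentagonalSeries (ZMod 3))) =
      ∑ l ∈ Icc (-N : ℤ) N, if 7 * pentagonal l = b then ((l.negOnePow : ℤ) : ZMod 3) else 0 := by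
    intro b hb
    rw [coeff_expand]
    split_ifs with h7
    · obtain ⟨c, rfl⟩ := h7
      rw [Nat.mul_div_cancel_left c (by norm_num),
        coeff_pentagonalSeries_eq_sum (show c ≤ N by omega)]
      simp
    · refine (sum_eq_zero fun l _ ↦ if_neg fun hl ↦ h7 ⟨_, hl.symm⟩).symm
  rw [natCast_B_eq_coeff, coeff_mul, sum_filter, sum_product]
  calc _ = ∑ x ∈ antidiagonal N, ∑ k ∈ Icc (-N : ℤ) N, ∑ l ∈ Icc (-N : ℤ) N,
        (if (pentagonal k, 7 * pentagonal l) = x then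
          (((k + l).negOnePow : ℤ) : ZMod 3) else 0) := by
        refine sum_congr rfl fun x hx ↦ ?_
        rw [HasAntidiagonal.mem_antidiagonal] at hx
        rw [coeff_pentagonalSeries_eq_sum (show x.1 ≤ N by omega), hexp x.2 (by omega),
          sum_mul_sum]
        refine sum_congr rfl fun k _ ↦ sum_congr rfl fun l _ ↦ ?_
        rw [ite_zero_mul_ite_zero]
        simp [Prod.ext_iff, Int.negOnePow_add]
    _ = _ := by
        rw [sum_comm]
        refine sum_congr rfl fun k _ ↦ ?_
        rw [sum_comm]
        refine sum_congr rfl fun l _ ↦ ?_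
        rw [sum_ite_eq]
        simp

/-- The norm form of the ring of integers of `ℚ(√-7)`. -/
def normForm (z : ℤ × ℤ) : ℤ := z.1 ^ 2 + z.1 * z.2 + 2 * z.2 ^ 2

/-- The elements of norm `M`. -/
noncomputable def normSet (M : ℕ) : Finset (ℤ × ℤ) :=
  {z ∈ Icc (-(2 * M) : ℤ) (2 * M) ×ˢ Icc (-(2 * M) : ℤ) (2 * M) | normForm z = M}

theorem mem_normSet {M : ℕ} {z : ℤ × ℤ} : z ∈ normSet M ↔ normForm z = M := by
  rw [normSet, mem_filter, and_iff_right_iff_imp]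
  obtain ⟨u, v⟩ := z
  intro h
  simp only [normForm] at h
  simp only [mem_product, mem_Icc]
  have h1 : u ^ 2 ≤ 2 * (M : ℤ) := by nlinarith [sq_nonneg (u + 2 * v), sq_nonneg v, sq_nonneg u]
  have h2 : v ^ 2 ≤ 2 * (M : ℤ) := by nlinarith [sq_nonneg (2 * u + v), sq_nonneg v]
  refine ⟨⟨?_, ?_⟩, ?_, ?_⟩ <;> nlinarith

/-- The residue modulo `3` of the real part of `z ^ 2`. -/
def weight (z : ℤ × ℤ) : ZMod 3 := z.1 * (z.1 + z.2)

/-- Multiplication in the ring of integers of `ℚ(√-7)`, in the basis `1, (1 + √-7) / 2`. -/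
def qmul (z w : ℤ × ℤ) : ℤ × ℤ :=
  (z.1 * w.1 - 2 * z.2 * w.2, z.1 * w.2 + z.2 * w.1 + z.2 * w.2)

/-- Conjugation in the ring of integers of `ℚ(√-7)`. -/
def qconj (z : ℤ × ℤ) : ℤ × ℤ := (z.1 + z.2, -z.2)

theorem normForm_qmul (z w : ℤ × ℤ) : normForm (qmul z w) = normForm z * normForm w := by
  simp only [normForm, qmul]
  ring

theorem normForm_qconj (z : ℤ × ℤ) : normForm (qconj z) = normForm z := by
  simp only [normForm, qconj]
  ring

theorem qconj_qconj (z : ℤ × ℤ) : qconj (qconj z) = z := by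
  ext <;> simp [qconj]

theorem weight_qconj (z : ℤ × ℤ) : weight (qconj z) = weight z := by
  simp only [weight, qconj]
  push_cast
  ring

theorem weight_qmul_qconj {z w : ℤ × ℤ} (hz : normForm z % 3 = 2) (hw : normForm w % 3 = 2) :
    weight (qmul z (qconj w)) = -weight (qmul z w) := by
  obtain ⟨a, b⟩ := z
  obtain ⟨c, d⟩ := w
  have key : ∀ a b c d : ZMod 3, a ^ 2 + a * b + 2 * b ^ 2 = 2 → c ^ 2 + c * d + 2 * d ^ 2 = 2 →
      (a * (c + d) - 2 * b * -d) * ((a * (c + d) - 2 * b * -d) +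
        (a * -d + b * (c + d) + b * -d)) =
      -((a * c - 2 * b * d) * ((a * c - 2 * b * d) + (a * d + b * c + b * d))) := by
    decide
  have cast : ∀ x y : ℤ, normForm (x, y) % 3 = 2 →
      (x : ZMod 3) ^ 2 + x * y + 2 * y ^ 2 = 2 := by
    intro x y h
    have : ((normForm (x, y) : ℤ) : ZMod 3) = ((2 : ℤ) : ZMod 3) :=
      (ZMod.intCast_eq_intCast_iff' _ _ 3).2 h
    simpa [normForm] using this
  have := key a b c d (cast a b hz) (cast c d hw)
  simpa [weight, qmul, qconj] using this

/-- A binary quadratic form of discriminant `-7` represents what the norm form represents. -/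
theorem exists_normForm_eq {n : ℕ} (hn : 0 < n) : ∀ {B c : ℤ}, B ^ 2 + 7 = 4 * n * c →
    ∃ z w : ℤ × ℤ, normForm z = n ∧ normForm w = c ∧
      2 * z.1 * w.1 + z.1 * w.2 + z.2 * w.1 + 4 * z.2 * w.2 = B := by
  induction n using Nat.strong_induction_on with
  | _ n ih =>
  intro B c h
  -- reduce `B` modulo `2 * n`
  obtain ⟨q, B', hB, hB'⟩ : ∃ q B' : ℤ, B = B' + 2 * n * q ∧ |B'| ≤ n := by
    refine ⟨B.bdiv (2 * n), B.bmod (2 * n), ?_, ?_⟩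
    · have := Int.bmod_add_bdiv B (2 * n)
      push_cast at this ⊢
      linarith
    · have h1 := Int.le_bmod (x := B) (m := 2 * n) (by omega)
      have h2 := Int.bmod_le (x := B) (m := 2 * n) (by omega)
      push_cast at h1 h2
      rw [abs_le]
      omega
  set c' : ℤ := c - B' * q - n * q ^ 2 with hc'
  have h' : B' ^ 2 + 7 = 4 * n * c' := by
    rw [hc']; subst hB; linear_combination h
  suffices H : ∃ z w : ℤ × ℤ, normForm z = n ∧ normForm w = c' ∧
      2 * z.1 * w.1 + z.1 * w.2 + z.2 * w.1 + 4 * z.2 * w.2 = B' by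
    obtain ⟨z, w, hz, hw, hzw⟩ := H
    refine ⟨z, (w.1 + q * z.1, w.2 + q * z.2), hz, ?_, ?_⟩ <;> simp only [normForm] at *
    · linear_combination hw + q * hzw + q ^ 2 * hz + hc'
    · linear_combination hzw + 2 * q * hz - hB
  have hsq : B' ^ 2 ≤ (n : ℤ) ^ 2 := sq_le_sq' (abs_le.1 hB').1 (abs_le.1 hB').2
  have hn' : (0 : ℤ) < n := by exact_mod_cast hn
  have hc0 : 0 < c' := by
    by_contra hcon
    nlinarith [sq_nonneg B']
  rcases Nat.lt_or_ge 1 n with h1 | h1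
  · have hlt : c' < n := by
      have : (2 : ℤ) ≤ n := by exact_mod_cast h1
      nlinarith
    obtain ⟨m, hm⟩ := Int.eq_ofNat_of_zero_le hc0.le
    rw [hm] at h' hc0 hlt ⊢
    obtain ⟨z, w, hz, hw, hzw⟩ := ih m (by exact_mod_cast hlt) (by exact_mod_cast hc0)
      (B := B') (c := n) (by linear_combination h')
    exact ⟨w, z, hw, hz, by linear_combination hzw⟩
  · obtain rfl : n = 1 := by omega
    obtain ⟨k, hk⟩ : ∃ k, B' = 2 * k + 1 := by
      have : ¬ Even B' := by
        rintro ⟨r, hr⟩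
        rw [hr] at h'
        push_cast at h'
        ring_nf at h'
        omega
      exact Int.not_even_iff_odd.1 this
    refine ⟨(1, 0), (k, 1), by simp [normForm], ?_, ?_⟩
    · simp only [normForm]
      rw [hk] at h'
      push_cast at h'
      linarith
    · simp only; linarith

/-- Weighted count of the elements of norm `M`. -/
noncomputable def weightSum (M : ℕ) : ZMod 3 := ∑ z ∈ normSet M, weight z

/-- Weighted count of the elements of norm `M` divisible by `p`. -/
noncomputable def weightSumDvd (p M : ℕ) : ZMod 3 :=
  ∑ z ∈ normSet M with (p : ℤ) ∣ z.1 ∧ (p : ℤ) ∣ z.2, weight z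

theorem weightSumDvd_sq_mul {p : ℕ} (hp : p.Prime) (hp3 : p % 3 = 2) (M : ℕ) :
    weightSumDvd p (p ^ 2 * M) = weightSum M := by
  have h0 : (p : ℤ) ≠ 0 := by exact_mod_cast hp.ne_zero
  have hc : (p : ZMod 3) ^ 2 = 1 := by
    have : (p : ZMod 3) = (2 : ℕ) := (ZMod.natCast_eq_natCast_iff' p 2 3).2 hp3
    rw [this]; decide
  symm
  refine sum_bij (fun z _ ↦ ((p : ℤ) * z.1, (p : ℤ) * z.2)) ?_ ?_ ?_ ?_
  · intro z hz
    rw [mem_normSet, normForm] at hz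
    simp only [mem_filter, mem_normSet, dvd_mul_right, and_self, and_true, normForm]
    push_cast
    linear_combination (p : ℤ) ^ 2 * hz
  · intro z _ w _ h
    simpa [Prod.ext_iff, hp.ne_zero] using h
  · rintro ⟨u, v⟩ h
    simp only [mem_filter, mem_normSet, normForm] at h
    obtain ⟨h, ⟨a, rfl⟩, b, rfl⟩ := h
    refine ⟨(a, b), ?_, rfl⟩
    rw [mem_normSet, normForm]
    apply mul_left_cancel₀ (pow_ne_zero 2 h0)
    push_cast at h
    linear_combination h
  · intro z _
    simp only [weight]
    push_cast
    linear_combination (-(z.1 * (z.1 + z.2) : ZMod 3)) * hc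

theorem weightSumDvd_mul_eq_zero {p : ℕ} (hp : p.Prime) {m : ℕ} (hm : ¬ p ∣ m) :
    weightSumDvd p (p * m) = 0 := by
  have h0 : (p : ℤ) ≠ 0 := by exact_mod_cast hp.ne_zero
  refine sum_eq_zero fun z hz ↦ absurd ?_ hm
  obtain ⟨u, v⟩ := z
  simp only [mem_filter, mem_normSet, normForm] at hz
  obtain ⟨h, ⟨a, rfl⟩, b, rfl⟩ := hz
  rw [← Int.natCast_dvd_natCast]
  refine ⟨a ^ 2 + a * b + 2 * b ^ 2, mul_left_cancel₀ h0 ?_⟩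
  push_cast at h
  linear_combination -h

theorem dvd_or_exists_normForm_eq {p : ℕ} (hp : p.Prime) :
    (∃ w, normForm w = p) ∨
      ∀ z : ℤ × ℤ, (p : ℤ) ∣ normForm z → (p : ℤ) ∣ z.1 ∧ (p : ℤ) ∣ z.2 := by
  have hpi : Prime (p : ℤ) := Nat.prime_iff_prime_int.1 hp
  refine or_iff_not_imp_right.2 fun H ↦ ?_
  push Not at H
  obtain ⟨⟨u, v⟩, hd, hz⟩ := H
  have hv : ¬ (p : ℤ) ∣ v := by
    intro hv
    refine hz ?_ hv
    refine hpi.dvd_of_dvd_pow (n := 2) ?_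
    have := dvd_sub hd (hv.mul_left (u + 2 * v))
    convert this using 1
    simp only [normForm]
    ring
  obtain ⟨x, y, hxy⟩ := (Int.isCoprime_iff_gcd_eq_one.2
    (((Int.prime_iff_natAbs_prime.1 hpi).coprime_iff_not_dvd).2 (by
      rwa [← Int.natAbs_dvd_natAbs] at hv)) : IsCoprime (p : ℤ) v)
  -- `t = u / v` modulo `p`
  obtain ⟨e, he⟩ := hd
  simp only [normForm] at he
  have hdvd : (p : ℤ) ∣ (u * y) ^ 2 + u * y + 2 := by
    have hyv : y * v = 1 - x * p := by linarith
    refine ⟨y ^ 2 * e + x * (u * y + 2 + 2 * y * v), ?_⟩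
    linear_combination y ^ 2 * he + (u * y + 2 + 2 * y * v) * (-hyv)
  obtain ⟨c, hc⟩ := hdvd
  obtain ⟨w, _, hw, _⟩ := exists_normForm_eq hp.pos (B := 2 * (u * y) + 1) (c := c)
    (by linear_combination 4 * hc)
  exact ⟨w, hw⟩

theorem sum_eq_zero_of_involution {s : Finset (ℤ × ℤ)} {f : ℤ × ℤ → ZMod 3}
    (g : ℤ × ℤ → ℤ × ℤ) (hg : ∀ z ∈ s, g z ∈ s) (hgg : ∀ z ∈ s, g (g z) = z)
    (hf : ∀ z ∈ s, f (g z) = -f z) : ∑ z ∈ s, f z = 0 := by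
  have h : ∑ z ∈ s, f z = ∑ z ∈ s, -f z :=
    sum_nbij' g g hg hg hgg hgg fun z hz ↦ by rw [hf z hz, neg_neg]
  rw [sum_neg_distrib] at h
  exact (by decide : ∀ x : ZMod 3, x = -x → x = 0) _ h

theorem weightSum_prime_mul {p m : ℕ} (hp : p.Prime) (hp3 : p % 3 = 2) (hm : m % 3 = 2) :
    weightSum (p * m) = weightSumDvd p (p * m) ∨ weightSum (p * m) = -weightSumDvd p (p * m) := by
  have h0 : (p : ℤ) ≠ 0 := by exact_mod_cast hp.ne_zero
  have hpi : Prime (p : ℤ) := Nat.prime_iff_prime_int.1 hp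
  rcases dvd_or_exists_normForm_eq hp with ⟨⟨a, b⟩, hw⟩ | H
  swap
  · left
    rw [weightSumDvd, filter_true_of_mem, weightSum]
    intro z hz
    rw [mem_normSet] at hz
    exact H z (hz ▸ by simp)
  right
  have hw' : a ^ 2 + a * b + 2 * b ^ 2 = p := hw
  have hb : ¬ (p : ℤ) ∣ b := by
    intro hb
    have ha : (p : ℤ) ∣ a := by
      refine hpi.dvd_of_dvd_pow (n := 2) ?_
      have := dvd_sub (dvd_refl (p : ℤ)) (hb.mul_left (a + 2 * b))
      convert this using 1
      linear_combination hw'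
    obtain ⟨c, rfl⟩ := ha
    obtain ⟨d, rfl⟩ := hb
    have : (p : ℤ) * (c ^ 2 + c * d + 2 * d ^ 2) = 1 :=
      mul_left_cancel₀ h0 (by linear_combination hw')
    exact hpi.not_isUnit (IsUnit.of_mul_eq_one _ this)
  have h2ab : ¬ (p : ℤ) ∣ 2 * a + b := by
    intro h
    have h7 : (p : ℤ) ∣ 7 * b ^ 2 := by
      rw [show 7 * b ^ 2 = 4 * (p : ℤ) - (2 * a + b) * (2 * a + b) by linear_combination 4 * hw']
      exact dvd_sub (dvd_mul_left _ _) (h.mul_left _)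
    rcases hpi.dvd_or_dvd h7 with h7 | h7
    · have := (Nat.prime_dvd_prime_iff_eq hp (by norm_num : Nat.Prime 7)).1 (by exact_mod_cast h7)
      omega
    · exact hb (hpi.dvd_of_dvd_pow h7)
  set S := normSet (p * m) with hS
  set A := {z ∈ S | (p : ℤ) ∣ a * z.2 - b * z.1} with hA
  set A' := {z ∈ S | (p : ℤ) ∣ a * z.2 + b * z.1 + b * z.2} with hA'
  have hunion : A ∪ A' = S := by
    rw [hA, hA', ← filter_or, filter_true_of_mem]
    intro z hz
    rw [hS, mem_normSet, normForm] at hz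
    rw [← dvd_neg, ← hpi.dvd_mul]
    push_cast at hz
    refine ⟨m * b ^ 2 - z.2 ^ 2, ?_⟩
    linear_combination b ^ 2 * hz - z.2 ^ 2 * hw'
  have hinter : A ∩ A' = {z ∈ S | (p : ℤ) ∣ z.1 ∧ (p : ℤ) ∣ z.2} := by
    rw [hA, hA', ← filter_and]
    refine filter_congr fun z _ ↦ ⟨?_, ?_⟩
    · rintro ⟨h1, h2⟩
      have hv : (p : ℤ) ∣ z.2 := by
        refine (hpi.dvd_or_dvd (a := 2 * a + b) ?_).resolve_left h2ab
        convert dvd_add h1 h2 using 1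
        ring
      refine ⟨(hpi.dvd_or_dvd (a := b) ?_).resolve_left hb, hv⟩
      convert dvd_sub (hv.mul_left a) h1 using 1
      ring
    · rintro ⟨h1, h2⟩
      exact ⟨dvd_sub (h2.mul_left a) (h1.mul_left b),
        dvd_add (dvd_add (h2.mul_left a) (h1.mul_left b)) (h2.mul_left b)⟩
  have hconj : ∑ z ∈ A', weight z = ∑ z ∈ A, weight z := by
    refine sum_nbij' qconj qconj ?_ ?_ (fun z _ ↦ qconj_qconj z) (fun z _ ↦ qconj_qconj z)
      fun z _ ↦ (weight_qconj z).symm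
    · intro z hz
      rw [hA', mem_filter, hS, mem_normSet] at hz
      rw [hA, mem_filter, hS, mem_normSet, normForm_qconj]
      refine ⟨hz.1, ?_⟩
      rw [← dvd_neg]
      convert! hz.2 using 1
      simp only [qconj]
      ring
    · intro z hz
      rw [hA, mem_filter, hS, mem_normSet] at hz
      rw [hA', mem_filter, hS, mem_normSet, normForm_qconj]
      refine ⟨hz.1, ?_⟩
      rw [← dvd_neg]
      convert! hz.2 using 1
      simp only [qconj]
      ring
  have hA0 : ∑ z ∈ A, weight z = 0 := by
    have hbij : ∑ z ∈ normSet m, weight (qmul (a, b) z) = ∑ z ∈ A, weight z := by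
      refine sum_bij (fun z _ ↦ qmul (a, b) z) ?_ ?_ ?_ (fun _ _ ↦ rfl)
      · intro z hz
        rw [mem_normSet] at hz
        rw [hA, mem_filter, hS, mem_normSet, normForm_qmul, hz, hw]
        refine ⟨by push_cast; ring, z.2, ?_⟩
        simp only [qmul]
        linear_combination z.2 * hw'
      · intro z _ z' _ h
        have h' := congrArg (qmul (qconj (a, b))) h
        simp only [qmul, qconj, Prod.ext_iff] at h'
        ext
        · refine mul_left_cancel₀ h0 ?_
          linear_combination h'.1 - (z.1 - z'.1) * hw'
        · refine mul_left_cancel₀ h0 ?_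
          linear_combination h'.2 - (z.2 - z'.2) * hw'
      · rintro ⟨u, v⟩ hz
        rw [hA, mem_filter, hS, mem_normSet, normForm] at hz
        obtain ⟨hz, d, hd⟩ := hz
        push_cast at hz
        simp only at hz hd
        obtain ⟨c, hc⟩ : (p : ℤ) ∣ (a + b) * u + 2 * b * v := by
          refine hpi.dvd_of_dvd_pow (n := 2) ?_
          refine ⟨p * m - ((a + b) * u + 2 * b * v) * d - 2 * p * d ^ 2, ?_⟩
          have e : (((a + b) * u + 2 * b * v) ^ 2 + ((a + b) * u + 2 * b * v) * (a * v - b * u)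
              + 2 * (a * v - b * u) ^ 2 : ℤ) = p * (p * m) := by
            rw [← hz, ← hw']; ring
          rw [hd] at e
          linear_combination e
        refine ⟨(c, d), ?_, ?_⟩
        · rw [mem_normSet, normForm]
          refine mul_left_cancel₀ (pow_ne_zero 2 h0) ?_
          have e : (((a + b) * u + 2 * b * v) ^ 2 + ((a + b) * u + 2 * b * v) * (a * v - b * u)
              + 2 * (a * v - b * u) ^ 2 : ℤ) = p * (p * m) := by
            rw [← hz, ← hw']; ring
          rw [hd, hc] at e
          linear_combination e
        · ext <;> simp only [qmul] <;> refine mul_left_cancel₀ h0 ?_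
          · linear_combination u * hw' - a * hc + 2 * b * hd
          · linear_combination v * hw' - b * hc - (a + b) * hd
    rw [← hbij]
    have hp3' : normForm (a, b) % 3 = 2 := by rw [hw]; omega
    refine sum_eq_zero_of_involution qconj ?_ (fun z _ ↦ qconj_qconj z) ?_
    · intro z hz
      rwa [mem_normSet, normForm_qconj, ← mem_normSet]
    · intro z hz
      rw [mem_normSet] at hz
      exact weight_qmul_qconj hp3' (by rw [hz]; omega)
  have := sum_union_inter (s₁ := A) (s₂ := A') (f := weight)
  rw [hunion, hinter, hconj, hA0, add_zero] at this
  exact eq_neg_of_add_eq_zero_left this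

theorem weightSum_eq_zero {p m : ℕ} (hp : p.Prime) (hp3 : p % 3 = 2) (hm : ¬ p ∣ m) (e : ℕ)
    (h : p ^ (2 * e + 1) * m % 3 = 1) : weightSum (p ^ (2 * e + 1) * m) = 0 := by
  have hodd : ∀ n, p * n % 3 = 1 → n % 3 = 2 := by
    intro n hn
    rw [Nat.mul_mod, hp3] at hn
    omega
  induction e with
  | zero =>
    rw [mul_zero, zero_add, pow_one] at h ⊢
    have := weightSum_prime_mul hp hp3 (hodd m h)
    rwa [weightSumDvd_mul_eq_zero hp hm, neg_zero, or_self] at this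
  | succ e ih =>
    have h1 : p ^ (2 * (e + 1) + 1) * m = p * (p * (p ^ (2 * e + 1) * m)) := by ring
    rw [h1] at h ⊢
    have h2 := hodd _ h
    have h3 : p ^ (2 * e + 1) * m % 3 = 1 := by
      rw [Nat.mul_mod, hp3] at h2
      omega
    have := weightSum_prime_mul hp hp3 h2
    rw [← mul_assoc p p, ← sq, weightSumDvd_sq_mul hp hp3, ih h3, neg_zero, or_self] at this
    rwa [← mul_assoc p p, ← sq]

theorem intCast_zmod_three_cases (x : ℤ) :
    x % 3 = 0 ∧ (x : ZMod 3) = 0 ∨ x % 3 = 1 ∧ (x : ZMod 3) = 1 ∨ x % 3 = 2 ∧ (x : ZMod 3) = 2 := by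
  have h (c : ℤ) (hc : x % 3 = c % 3) : (x : ZMod 3) = (c : ℤ) :=
    (ZMod.intCast_eq_intCast_iff' x c 3).2 hc
  have : x % 3 = 0 ∨ x % 3 = 1 ∨ x % 3 = 2 := by omega
  rcases this with h0 | h0 | h0
  · exact .inl ⟨h0, by simpa using h 0 h0⟩
  · exact .inr (.inl ⟨h0, by simpa using h 1 h0⟩)
  · exact .inr (.inr ⟨h0, by simpa using h 2 h0⟩)

/-- Elements whose coordinates have an even sum cancel. -/
theorem sum_weight_even (M : ℕ) :
    ∑ z ∈ normSet M with Even (z.1 + z.2), weight z = 0 := by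
  refine sum_eq_zero_of_involution
    (fun z ↦ (-z.2 - (z.1 + z.2) / 2, z.2 - (z.1 + z.2) / 2)) ?_ ?_ ?_
  all_goals
    rintro ⟨u, v⟩ h
    simp only [mem_filter, mem_normSet, normForm] at h
    obtain ⟨h, k, hk⟩ := h
    obtain rfl : u = 2 * k - v := by omega
    have hk' : (2 * k - v + v) / 2 = k := by omega
  · simp only [hk', mem_filter, mem_normSet, normForm]
    exact ⟨by linear_combination h, -k, by ring⟩
  · simp only [hk']
    ext <;> simp only <;> omega
  · simp only [hk', weight]
    push_cast
    have : ∀ k v : ZMod 3,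
      (-v - k) * (-v - k + (v - k)) = -((2 * k - v) * (2 * k - v + v)) := by decide
    exact this _ _

theorem sum_weight_odd_eq_zero_iff (M : ℕ) :
    ∑ z ∈ normSet M with Odd (z.1 + z.2), weight z = 0 ↔
      ∑ z ∈ normSet M with Odd (z.1 + z.2) ∧ z.1 % 3 = 2, weight z = 0 := by
  set S := {z ∈ normSet M | Odd (z.1 + z.2)} with hS
  have h1 : ∑ z ∈ S with ¬ z.1 % 3 = 2, weight z = ∑ z ∈ S with z.1 % 3 = 1, weight z := by
    symm
    refine sum_subset (fun z hz ↦ ?_) fun z hz hz' ↦ ?_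
    · simp only [mem_filter] at hz ⊢
      exact ⟨hz.1, by omega⟩
    · simp only [mem_filter, not_and] at hz hz'
      have := hz' hz.1
      rcases intCast_zmod_three_cases z.1 with h | h | h
      · simp [weight, h.2]
      · omega
      · omega
  have h2 : ∑ z ∈ S with z.1 % 3 = 1, weight z = ∑ z ∈ S with z.1 % 3 = 2, weight z := by
    refine sum_nbij' (fun z ↦ -z) (fun z ↦ -z) ?_ ?_ (fun _ _ ↦ neg_neg _)
      (fun _ _ ↦ neg_neg _) ?_
    · intro z hz
      simp only [hS, mem_filter, mem_normSet, normForm, Prod.fst_neg, Prod.snd_neg] at hz ⊢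
      refine ⟨⟨by linear_combination hz.1.1, ?_⟩, by omega⟩
      have := hz.1.2.neg
      rwa [neg_add] at this
    · intro z hz
      simp only [hS, mem_filter, mem_normSet, normForm, Prod.fst_neg, Prod.snd_neg] at hz ⊢
      refine ⟨⟨by linear_combination hz.1.1, ?_⟩, by omega⟩
      have := hz.1.2.neg
      rwa [neg_add] at this
    · intro z _
      simp only [weight, Prod.fst_neg, Prod.snd_neg]
      push_cast
      ring
  rw [← sum_filter_add_sum_filter_not S (fun z ↦ z.1 % 3 = 2), h1, h2, hS, filter_filter]
  exact (by decide : ∀ x : ZMod 3, x + x = 0 ↔ x = 0) _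

theorem sum_negOnePow_eq_sum_weight (N : ℕ) :
    ∑ z ∈ Icc (-N : ℤ) N ×ˢ Icc (-N : ℤ) N with
      pentagonal z.1 + 7 * pentagonal z.2 = N, (((z.1 + z.2).negOnePow : ℤ) : ZMod 3) =
    ∑ z ∈ normSet (3 * N + 1) with Odd (z.1 + z.2) ∧ z.1 % 3 = 2, weight z := by
  -- `(k, l)` goes to `(u, v)` with `u - 3 * v = 6 * k - 1` and `u + v = ± (6 * l - 1)`
  have hpent : ∀ k l : ℤ, pentagonal k + 7 * pentagonal l = N ↔
      (6 * k - 1) ^ 2 + 7 * (6 * l - 1) ^ 2 = 24 * N + 8 := by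
    intro k l
    have hk := two_mul_natCast_pentagonal k
    have hl := two_mul_natCast_pentagonal l
    constructor
    · intro h
      have h' : (pentagonal k : ℤ) + 7 * pentagonal l = N := by exact_mod_cast h
      linear_combination 24 * h' - 12 * hk - 84 * hl
    · intro h
      have h' : (pentagonal k : ℤ) + 7 * pentagonal l = N := by linarith
      exact_mod_cast h'
  have hbound : ∀ k : ℤ, -(pentagonal k : ℤ) ≤ k ∧ k ≤ pentagonal k := by
    intro k
    have := two_mul_natCast_pentagonal k
    constructor <;> nlinarith
  refine sum_bij (fun z _ ↦ if Even (z.1 + z.2) then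
      ((9 * z.2 + 3 * z.1) / 2 - 1, (3 * z.2 - 3 * z.1) / 2) else
      ((3 * z.1 - 9 * z.2 + 1) / 2, (1 - 3 * z.2 - 3 * z.1) / 2)) ?_ ?_ ?_ ?_
  · rintro ⟨k, l⟩ h
    rw [mem_filter] at h
    have h' := (hpent k l).1 h.2
    simp only [mem_filter, mem_normSet, normForm]
    split_ifs with hp
    · obtain ⟨r, hr⟩ := hp
      obtain rfl : k = 2 * r - l := by omega
      have e1 : (9 * l + 3 * (2 * r - l)) / 2 - 1 = 3 * l + 3 * r - 1 := by omega
      have e2 : (3 * l - 3 * (2 * r - l)) / 2 = 3 * l - 3 * r := by omega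
      rw [e1, e2]
      refine ⟨?_, ⟨3 * l - 1, by ring⟩, by omega⟩
      push_cast
      linarith
    · rw [Int.not_even_iff_odd] at hp
      obtain ⟨r, hr⟩ := hp
      obtain rfl : k = 2 * r + 1 - l := by omega
      have e1 : (3 * (2 * r + 1 - l) - 9 * l + 1) / 2 = 3 * r - 6 * l + 2 := by omega
      have e2 : (1 - 3 * l - 3 * (2 * r + 1 - l)) / 2 = -1 - 3 * r := by omega
      simp only [e1, e2]
      refine ⟨?_, ⟨-3 * l, by ring⟩, by omega⟩
      push_cast
      linarith
  · rintro ⟨k, l⟩ _ ⟨k', l'⟩ _ h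
    simp only at h
    split_ifs at h <;> simp only [Prod.mk.injEq, Int.even_iff] at * <;> omega
  · rintro ⟨u, v⟩ h
    simp only [mem_filter, mem_normSet, normForm] at h
    obtain ⟨h, ⟨r, hr⟩, h3⟩ := h
    obtain ⟨k, hk⟩ : ∃ k, u - 3 * v = 6 * k - 1 := ⟨(u - 3 * v + 1) / 6, by omega⟩
    have hne : (u + v) % 3 ≠ 0 := by
      intro h0
      obtain ⟨s, hs⟩ : ∃ s, u + v = 3 * s := ⟨(u + v) / 3, by omega⟩
      have : u * (u + v) + 2 * v ^ 2 = 3 * N + 1 := by push_cast at h; linarith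
      obtain ⟨t, ht⟩ : ∃ t, v = 3 * t + 1 := ⟨(v - 1) / 3, by omega⟩
      rw [hs, ht] at this
      ring_nf at this
      omega
    have hmem : ∀ l, (u + v) ^ 2 = (6 * l - 1) ^ 2 →
        (k, l) ∈ {z ∈ Icc (-N : ℤ) N ×ˢ Icc (-N : ℤ) N | pentagonal z.1 + 7 * pentagonal z.2 = N} := by
      intro l hl
      have hkl : pentagonal k + 7 * pentagonal l = N := by
        rw [hpent, ← hk, ← hl]
        push_cast at h
        linarith
      have := hbound k
      have := hbound l
      simp only [mem_filter, mem_product, mem_Icc]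
      refine ⟨⟨⟨?_, ?_⟩, ?_, ?_⟩, hkl⟩ <;> omega
    rcases (by omega : (u + v) % 6 = 5 ∨ (u + v) % 6 = 1) with h6 | h6
    · obtain ⟨l, hl⟩ : ∃ l, u + v = 6 * l - 1 := ⟨(u + v + 1) / 6, by omega⟩
      refine ⟨(k, l), hmem l (by rw [hl]), ?_⟩
      have hp : Even (k + l) := by rw [Int.even_iff]; omega
      rw [if_pos hp]
      ext <;> simp only <;> omega
    · obtain ⟨l, hl⟩ : ∃ l, u + v = -(6 * l - 1) := ⟨(1 - (u + v)) / 6, by omega⟩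
      refine ⟨(k, l), hmem l (by rw [hl, neg_sq]), ?_⟩
      have hp : ¬ Even (k + l) := by rw [Int.not_even_iff]; omega
      simp only [if_neg hp]
      ext <;> simp only <;> omega
  · rintro ⟨k, l⟩ _
    simp only
    split_ifs with hp
    · obtain ⟨r, hr⟩ := id hp
      obtain rfl : k = 2 * r - l := by omega
      have e1 : (9 * l + 3 * (2 * r - l)) / 2 - 1 = 3 * (l + r) - 1 := by omega
      have e2 : (3 * l - 3 * (2 * r - l)) / 2 = 3 * (l - r) := by omega
      rw [e1, e2, Int.negOnePow_even _ hp, weight]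
      push_cast
      rw [show (3 : ZMod 3) = 0 from rfl]
      simp
    · have hp' := Int.not_even_iff_odd.1 hp
      obtain ⟨r, hr⟩ := id hp'
      obtain rfl : k = 2 * r + 1 - l := by omega
      have e1 : (3 * (2 * r + 1 - l) - 9 * l + 1) / 2 = 3 * (r - 2 * l) + 2 := by omega
      have e2 : (1 - 3 * l - 3 * (2 * r + 1 - l)) / 2 = 3 * (-r) - 1 := by omega
      simp only [e1, e2]
      rw [Int.negOnePow_odd _ hp', weight]
      push_cast
      rw [show (3 : ZMod 3) = 0 from rfl]
      simp
      decide

theorem natCast_B_eq_zero_iff (N : ℕ) : (B 3 7 N : ZMod 3) = 0 ↔ weightSum (3 * N + 1) = 0 := by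
  rw [natCast_B_eq_sum, sum_negOnePow_eq_sum_weight, ← sum_weight_odd_eq_zero_iff, weightSum,
    ← sum_filter_add_sum_filter_not (normSet _) (fun z ↦ Even (z.1 + z.2)),
    sum_weight_even, zero_add]
  simp only [Int.not_even_iff_odd]

/-- `B 3 7 N` is divisible by `3` when some prime `p ≡ 2 (mod 3)` divides `3 * N + 1` to an exact
odd power. -/
theorem B_three_seven_modEq_zero {N p m e : ℕ} (hp : p.Prime) (hp3 : p % 3 = 2) (hm : ¬ p ∣ m)
    (h : 3 * N + 1 = p ^ (2 * e + 1) * m) : B 3 7 N ≡ 0 [MOD 3] := by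
  rw [← ZMod.natCast_eq_natCast_iff, Nat.cast_zero, natCast_B_eq_zero_iff, h]
  exact weightSum_eq_zero hp hp3 hm e (by omega)

/-- Theorem 1.2(i): congruences modulo 3 for `B 3 7`.  Here `p 0, …, p k` play the role of
`p_1, …, p_{k+1}` in the paper. -/
theorem B_3_7_cong (k n j : ℕ) (p : ℕ → ℕ)
    (hp : ∀ i < k + 1, (p i).Prime ∧ p i % 3 = 2)
    (hj : ¬ p k ∣ j) :
    B 3 7 ((∏ i ∈ Finset.range (k + 1), (p i) ^ 2) * n
        + ((∏ i ∈ Finset.range k, (p i) ^ 2) * p k * (3 * j + p k) - 1) / 3)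
      ≡ 0 [MOD 3] := by
  obtain ⟨hpk, hpk3⟩ := hp k (by omega)
  set P := ∏ i ∈ Finset.range k, p i with hP
  have hP0 : P ≠ 0 := prod_ne_zero_iff.2 fun i hi ↦
    (hp i (by rw [mem_range] at hi; omega)).1.ne_zero
  obtain ⟨e, m, hm, hPm⟩ := Nat.exists_eq_pow_mul_and_not_dvd hP0 (p k) hpk.ne_one
  have hP3 : P ^ 2 % 3 = 1 := by
    have h : ¬ 3 ∣ P := by
      rw [hP, Prime.dvd_finsetProd_iff Nat.prime_three.prime]
      rintro ⟨i, hi, hd⟩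
      have := (hp i (by rw [mem_range] at hi; omega)).2
      omega
    rw [Nat.pow_mod]
    have : P % 3 = 1 ∨ P % 3 = 2 := by omega
    rcases this with h | h <;> rw [h]
  have hmod : P ^ 2 * p k * (3 * j + p k) % 3 = 1 := by
    rw [mul_assoc, Nat.mul_mod, hP3, Nat.mul_mod (p k), hpk3, Nat.mul_add_mod, hpk3]
  rw [prod_range_succ, prod_pow, ← hP]
  refine B_three_seven_modEq_zero hpk hpk3 (m := m ^ 2 * (3 * (p k * n) + 3 * j + p k)) (e := e)
    ?_ ?_
  · intro h
    rcases hpk.dvd_mul.1 h with h | h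
    · exact hm (hpk.dvd_of_dvd_pow h)
    · rw [Nat.dvd_add_left dvd_rfl, Nat.dvd_add_right ((dvd_mul_right _ _).mul_left 3)] at h
      rcases hpk.dvd_mul.1 h with h | h
      · have := (Nat.prime_dvd_prime_iff_eq hpk Nat.prime_three).1 h
        omega
      · exact hj h
  · have h1 : 3 * ((P ^ 2 * p k * (3 * j + p k) - 1) / 3) + 1 = P ^ 2 * p k * (3 * j + p k) := by
      omega
    rw [mul_add, add_assoc, h1, hPm]
    ring
end

section
/- Let k and n be nonnegative integers, let p_1, p_2, …, p_{k+1} be prime numbers with p_i ≡ 3 (mod 4) for each i ∈ {1, …, k+1}, and let j be a nonnegative integer with p_{k+1} ∤ j. Then B_{3,5}( p_1² p_2² ⋯ p_k² p_{k+1}² n + ( p_1² p_2² ⋯ p_k² · p_{k+1} (4j + p_{k+1}) − 1 ) / 4 ) ≡ 0 (mod 3). -/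
section BipartitionCongruence
open PowerSeries Finset

section QBinomial
variable {R : Type*} [CommRing R]

/-- The Gaussian binomial coefficient with base `Q`. -/
def gaussianBinomial (Q : R) : ℕ → ℕ → R
  | _, 0 => 1
  | 0, _ + 1 => 0
  | n + 1, k + 1 => gaussianBinomial Q n k + Q ^ (k + 1) * gaussianBinomial Q n (k + 1)

/-- The `q`-Pochhammer symbol `(Q; Q)_n`. -/
def qPochhammer (Q : R) (n : ℕ) : R := ∏ i ∈ range n, (1 - Q ^ (i + 1))

lemma gaussianBinomial_zero_right (Q : R) (n : ℕ) : gaussianBinomial Q n 0 = 1 := by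
  cases n <;> rfl

lemma gaussianBinomial_eq_zero_of_lt (Q : R) {n k : ℕ} (h : n < k) :
    gaussianBinomial Q n k = 0 := by
  induction n generalizing k with
  | zero => obtain ⟨k, rfl⟩ := Nat.exists_eq_add_one_of_ne_zero h.ne'; rfl
  | succ n ih =>
    obtain ⟨k, rfl⟩ := Nat.exists_eq_add_one_of_ne_zero (Nat.ne_zero_of_lt h)
    rw [gaussianBinomial, ih (by omega), ih (by omega)]
    simp

lemma qPochhammer_succ (Q : R) (n : ℕ) :
    qPochhammer Q (n + 1) = qPochhammer Q n * (1 - Q ^ (n + 1)) :=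
  prod_range_succ _ _

lemma gaussianBinomial_mul_qPochhammer (Q : R) (j k : ℕ) :
    gaussianBinomial Q (j + k) k * (qPochhammer Q j * qPochhammer Q k) =
      qPochhammer Q (j + k) := by
  induction h : j + k generalizing j k with
  | zero =>
    obtain ⟨rfl, rfl⟩ : j = 0 ∧ k = 0 := by omega
    simp [qPochhammer, gaussianBinomial]
  | succ n ih =>
    rcases k with _ | k
    · obtain rfl : j = n + 1 := by omega
      simp [gaussianBinomial_zero_right, qPochhammer]
    · have h1 := ih j k (by omega)
      rw [gaussianBinomial, qPochhammer_succ, qPochhammer_succ Q n]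
      rcases j with _ | j
      · obtain rfl : k = n := by omega
        rw [gaussianBinomial_eq_zero_of_lt Q (Nat.lt_succ_self k)]
        linear_combination (1 - Q ^ (k + 1)) * h1
      · have h2 := ih j (k + 1) (by omega)
        obtain rfl : n = j + k + 1 := by omega
        rw [qPochhammer_succ] at h1 h2 ⊢
        linear_combination (1 - Q ^ (k + 1)) * h1 + Q ^ (k + 1) * (1 - Q ^ (j + 1)) * h2

/-- Rothe's `q`-binomial theorem. -/
lemma prod_add_mul_pow_eq_sum (Q x y : R) (n : ℕ) :
    ∏ i ∈ range n, (y + x * Q ^ i) =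
      ∑ k ∈ range (n + 1),
        gaussianBinomial Q n k * Q ^ (k.choose 2) * x ^ k * y ^ (n - k) := by
  induction n generalizing x with
  | zero => simp [gaussianBinomial]
  | succ n ih =>
    have hprod : ∏ i ∈ range (n + 1), (y + x * Q ^ i) =
        (∏ i ∈ range n, (y + x * Q * Q ^ i)) * (y + x) := by
      rw [prod_range_succ']
      simp [pow_succ', mul_assoc]
    rw [hprod, ih, sum_range_succ' _ (n + 1), mul_add, sum_mul, sum_mul]
    have hx : ∀ k ∈ range (n + 1),
        gaussianBinomial Q n k * Q ^ (k.choose 2) * (x * Q) ^ k * y ^ (n - k) * x =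
        gaussianBinomial Q n k * Q ^ ((k + 1).choose 2) * x ^ (k + 1) * y ^ (n + 1 - (k + 1)) := by
      intro k _
      rw [Nat.choose_succ_succ' k 1, Nat.choose_one_right, Nat.add_sub_add_right]
      ring
    have hy : ∑ k ∈ range (n + 1),
        gaussianBinomial Q n k * Q ^ (k.choose 2) * (x * Q) ^ k * y ^ (n - k) * y =
        (∑ k ∈ range (n + 1), Q ^ (k + 1) * gaussianBinomial Q n (k + 1) *
          Q ^ ((k + 1).choose 2) * x ^ (k + 1) * y ^ (n + 1 - (k + 1))) + y ^ (n + 1) := by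
      rw [sum_range_succ', sum_range_succ _ n,
        gaussianBinomial_eq_zero_of_lt Q (Nat.lt_succ_self n)]
      simp only [gaussianBinomial_zero_right]
      have : ∀ k ∈ range n, gaussianBinomial Q n (k + 1) * Q ^ ((k + 1).choose 2) *
          (x * Q) ^ (k + 1) * y ^ (n - (k + 1)) * y = Q ^ (k + 1) * gaussianBinomial Q n (k + 1) *
          Q ^ ((k + 1).choose 2) * x ^ (k + 1) * y ^ (n + 1 - (k + 1)) := by
        intro k hk
        rw [mem_range] at hk
        rw [show n + 1 - (k + 1) = n - (k + 1) + 1 by omega]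
        ring
      rw [sum_congr rfl this]
      simp [pow_succ]
    rw [sum_congr rfl hx, hy]
    simp only [gaussianBinomial, add_mul, sum_add_distrib]
    simp
    ring

end QBinomial

section TripleProduct
variable {R : Type*} [CommRing R]

lemma prod_neg_X_pow_arith (c r N : ℕ) :
    ∏ i ∈ range N, (-X ^ (c + r * i) : R⟦X⟧) = (-1) ^ N * X ^ (c * N + r * N.choose 2) := by
  induction N with
  | zero => simp
  | succ N ih =>
    rw [prod_range_succ, ih, Nat.choose_succ_succ' N 1, Nat.choose_one_right]
    ring

lemma prod_X_pow_sub_X_pow (c d N : ℕ) :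
    ∏ i ∈ range (N + N), (X ^ ((c + d) * N) + -X ^ c * (X ^ (c + d)) ^ i : R⟦X⟧) =
      (-1) ^ N * (X ^ (c * N + (c + d) * N.choose 2 + (c + d) * N * N) *
        ∏ i ∈ range N, ((1 - X ^ (c + (c + d) * i)) * (1 - X ^ (d + (c + d) * i)))) := by
  have hlow : ∏ i ∈ range N, (X ^ ((c + d) * N) + -X ^ c * (X ^ (c + d)) ^ i : R⟦X⟧) =
      (∏ i ∈ range N, (-X ^ (c + (c + d) * i))) *
        ∏ i ∈ range N, (1 - X ^ (d + (c + d) * i)) := by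
    rw [← prod_range_reflect (fun i ↦ (1 - X ^ (d + (c + d) * i) : R⟦X⟧)), ← prod_mul_distrib]
    refine prod_congr rfl fun i hi ↦ ?_
    obtain ⟨j, rfl⟩ := Nat.exists_eq_add_of_lt (mem_range.mp hi)
    rw [show i + j + 1 - 1 - i = j by omega]
    ring
  have hhigh : ∏ i ∈ range N,
      (X ^ ((c + d) * N) + -X ^ c * (X ^ (c + d)) ^ (N + i) : R⟦X⟧) =
      X ^ ((c + d) * N * N) * ∏ i ∈ range N, (1 - X ^ (c + (c + d) * i)) := by
    have hconst : (X ^ ((c + d) * N * N) : R⟦X⟧) = ∏ i ∈ range N, X ^ ((c + d) * N) := by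
      rw [prod_const, card_range, ← pow_mul]
    rw [hconst, ← prod_mul_distrib]
    exact prod_congr rfl fun i _ ↦ by ring
  rw [prod_range_add, hlow, hhigh, prod_neg_X_pow_arith, prod_mul_distrib]
  ring

lemma X_pow_dvd_qPochhammer_sub {r : ℕ} (hr : 0 < r) {n m : ℕ} (h : n ≤ m) :
    (X ^ (n + 1) : R⟦X⟧) ∣ qPochhammer (X ^ r) m - qPochhammer (X ^ r) n := by
  induction m, h using Nat.le_induction with
  | base => simp
  | succ m hm ih =>
    rw [qPochhammer_succ]
    have h1 : (X ^ (n + 1) : R⟦X⟧) ∣ (X ^ r) ^ (m + 1) := by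
      rw [← pow_mul]
      exact pow_dvd_pow _ (by nlinarith)
    convert dvd_sub ih (h1.mul_left (qPochhammer (X ^ r) m)) using 1
    ring

lemma isUnit_qPochhammer_X_pow {r : ℕ} (hr : 0 < r) (n : ℕ) :
    IsUnit (qPochhammer (X ^ r) n : R⟦X⟧) := by
  rw [PowerSeries.isUnit_iff_constantCoeff, qPochhammer, map_prod]
  simp [hr.ne']

/-- Modulo `X ^ (n + 1)`, the central Gaussian binomials are inverse to `(X ^ r; X ^ r)_∞`. -/
lemma X_pow_dvd_gaussianBinomial_mul_qPochhammer_sub_one {r : ℕ} (hr : 0 < r) {n j k N : ℕ}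
    (hj : n ≤ j) (hk : n ≤ k) (hN : n ≤ N) :
    (X ^ (n + 1) : R⟦X⟧) ∣
      gaussianBinomial (X ^ r) (j + k) k * qPochhammer (X ^ r) N - 1 := by
  set V : R⟦X⟧ := qPochhammer (X ^ r) n with hV
  set g : R⟦X⟧ := gaussianBinomial (X ^ r) (j + k) k with hg
  have h1 := X_pow_dvd_qPochhammer_sub (R := R) hr hj
  have h2 := X_pow_dvd_qPochhammer_sub (R := R) hr hk
  have h3 := X_pow_dvd_qPochhammer_sub (R := R) hr (hj.trans (Nat.le_add_right j k))
  have h4 := X_pow_dvd_qPochhammer_sub (R := R) hr hN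
  have h5 := gaussianBinomial_mul_qPochhammer (X ^ r : R⟦X⟧) j k
  rw [← hV] at h1 h2 h3 h4
  rw [← hg] at h5
  have h6 : (X ^ (n + 1) : R⟦X⟧) ∣ V * (g * V - 1) := by
    have := (h3.sub (h1.mul_left (g * qPochhammer (X ^ r) k))).sub (h2.mul_left (g * V))
    convert this using 1
    linear_combination h5
  rw [(isUnit_qPochhammer_X_pow hr n).dvd_mul_left] at h6
  convert h6.add (h4.mul_left g) using 1
  ring

lemma two_mul_abs_le_quadratic {c d : ℕ} (hc : 0 < c) (hd : 0 < d) (m : ℤ) :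
    2 * |m| ≤ (c + d) * m ^ 2 + (c - d) * m := by
  have hc' : (0 : ℤ) ≤ c - 1 := by omega
  have hd' : (0 : ℤ) ≤ d - 1 := by omega
  have h1 : 0 ≤ m * (m + 1) := by
    rcases lt_or_ge m 0 with h | h <;> nlinarith
  have h2 : 0 ≤ m * (m - 1) := by
    rcases lt_or_ge 0 m with h | h <;> nlinarith
  have h3 : |m| ≤ m ^ 2 := abs_le.mpr ⟨by linarith, by linarith⟩
  linear_combination 2 * h3 + mul_nonneg hc' h1 + mul_nonneg hd' h2

/-- The support statement contained in the Jacobi triple product identity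
`(q ^ c; q ^ r)_∞ (q ^ d; q ^ r)_∞ (q ^ r; q ^ r)_∞ = ∑ (-1) ^ m q ^ ((r m² + (c - d) m) / 2)`,
where `r = c + d`. -/
lemma exists_of_coeff_tripleProduct_ne_zero {c d : ℕ} (hc : 0 < c) (hd : 0 < d) {n N : ℕ}
    (hN : 2 * n ≤ N)
    (h : coeff n ((∏ i ∈ range N,
      ((1 - X ^ (c + (c + d) * i)) * (1 - X ^ (d + (c + d) * i)))) *
        qPochhammer (X ^ (c + d)) N : R⟦X⟧) ≠ 0) :
    ∃ m : ℤ, (2 * n : ℤ) = (c + d) * m ^ 2 + (c - d) * m := by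
  set P : R⟦X⟧ := ∏ i ∈ range N,
      ((1 - X ^ (c + (c + d) * i)) * (1 - X ^ (d + (c + d) * i))) with hP
  set U : R⟦X⟧ := qPochhammer (X ^ (c + d)) N with hU
  set E := c * N + (c + d) * N.choose 2 + (c + d) * N * N with hE
  have key : X ^ E * (P * U) = ∑ k ∈ range (N + N + 1),
      (-1) ^ (N + k) * (gaussianBinomial (X ^ (c + d)) (N + N) k * U *
        X ^ ((c + d) * k.choose 2 + c * k + (c + d) * N * (N + N - k))) := by
    have h1 := prod_X_pow_sub_X_pow (R := R) c d N
    rw [prod_add_mul_pow_eq_sum] at h1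
    have h2 : ((-1) ^ N * (-1) ^ N : R⟦X⟧) = 1 := by rw [← mul_pow]; simp
    calc X ^ E * (P * U) = ((-1) ^ N * U) * ((-1) ^ N * (X ^ E * P)) := by
          linear_combination - (X ^ E * P * U) * h2
      _ = _ := by
          rw [← h1, mul_sum]
          refine sum_congr rfl fun k _ ↦ ?_
          rw [neg_pow (X ^ c) k]
          ring
  have hcoeff : coeff (n + E) (X ^ E * (P * U)) ≠ 0 := by rwa [coeff_X_pow_mul]
  rw [key, map_sum] at hcoeff
  obtain ⟨k, hk, hk0⟩ := exists_ne_zero_of_sum_ne_zero hcoeff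
  rw [mem_range] at hk
  have hsign : ((-1) ^ (N + k) : R⟦X⟧) = C ((-1) ^ (N + k)) := by simp
  rw [hsign, coeff_C_mul, coeff_mul_X_pow'] at hk0
  replace hk0 := right_ne_zero_of_mul hk0
  set e := (c + d) * k.choose 2 + c * k + (c + d) * N * (N + N - k) with he
  have hle : e ≤ n + E := by
    by_contra hlt
    simp [hlt] at hk0
  rw [if_pos hle] at hk0
  have hchoose : ∀ a : ℕ, (2 * (a.choose 2 : ℤ)) = a * (a - 1) := fun a ↦ by
    rcases a with _ | a
    · simp
    · have := Nat.add_one_mul_choose_eq a 1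
      simp only [Nat.choose_one_right] at this
      push_cast
      zify at this
      linarith
  have hdiff : (2 * (e - E : ℤ)) = (c + d) * (k - N : ℤ) ^ 2 + (c - d) * (k - N : ℤ) := by
    rw [he, hE]
    push_cast [Nat.cast_sub (show k ≤ N + N by omega)]
    linear_combination (c + d : ℤ) * hchoose k - (c + d : ℤ) * hchoose N
  have habs : |(k - N : ℤ)| ≤ n := by
    have h1 : (e : ℤ) ≤ n + E := by exact_mod_cast hle
    have h2 := two_mul_abs_le_quadratic hc hd (k - N : ℤ)
    linarith
  have hEe : E ≤ e := by
    have h2 := two_mul_abs_le_quadratic hc hd (k - N : ℤ)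
    have h3 := abs_nonneg (k - N : ℤ)
    zify
    linarith
  rw [abs_le] at habs
  obtain ⟨w, hw⟩ := X_pow_dvd_gaussianBinomial_mul_qPochhammer_sub_one (R := R)
    (Nat.add_pos_left hc d) (n := n) (j := N + N - k) (k := k) (N := N)
    (by omega) (by omega) (by omega)
  rw [show N + N - k + k = N + N by omega, sub_eq_iff_eq_add] at hw
  rw [hw, map_add, coeff_X_pow_mul', if_neg (by omega), zero_add, coeff_one] at hk0
  have heq : n + E - e = 0 := by
    by_contra hne
    exact hk0 (if_neg hne)
  refine ⟨k - N, ?_⟩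
  rw [← hdiff]
  have : (e : ℤ) = n + E := by exact_mod_cast (by omega : e = n + E)
  linarith

end TripleProduct

section Generating
open Nat.Partition PowerSeries.WithPiTopology

lemma multipliable_one_sub_X_pow_mul (R : Type*) [CommRing R] [TopologicalSpace R] {t : ℕ}
    (ht : 0 < t) : Multipliable fun i ↦ (1 : R⟦X⟧) - X ^ ((i + 1) * t) := by
  nontriviality R
  simp_rw [sub_eq_add_neg]
  apply multipliable_one_add_of_tendsto_order_atTop_nhds_top
  refine ENat.tendsto_nhds_top_iff_natCast_lt.mpr (fun n ↦ Filter.eventually_atTop.mpr ⟨n, ?_⟩)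
  intro m hm
  rw [order_neg, order_X_pow]
  norm_cast
  nlinarith

lemma regularPartitionCount_eq_card_restricted (t n : ℕ) :
    regularPartitionCount t n = #(restricted n (¬ t ∣ ·)) := by
  rw [regularPartitionCount, Nat.card_eq_fintype_card, Fintype.card_subtype, restricted]

lemma mk_B_eq_mul (R : Type*) [CommRing R] (u v : ℕ) :
    (PowerSeries.mk fun n ↦ (B u v n : R)) =
      (PowerSeries.mk fun n ↦ (regularPartitionCount u n : R)) *
        PowerSeries.mk fun n ↦ (regularPartitionCount v n : R) := by
  ext n
  rw [coeff_mul, coeff_mk, B,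
    Nat.sum_antidiagonal_eq_sum_range_succ_mk]
  simp

lemma prod_range_five_mul (R : Type*) [CommRing R] (N : ℕ) :
    (∏ i ∈ range (5 * N), (1 - X ^ (i + 1)) : R⟦X⟧) =
      (∏ i ∈ range N, ((1 - X ^ (4 + (4 + 1) * i)) * (1 - X ^ (1 + (4 + 1) * i)))) *
      (∏ i ∈ range N, ((1 - X ^ (3 + (3 + 2) * i)) * (1 - X ^ (2 + (3 + 2) * i)))) *
        qPochhammer (X ^ 5) N := by
  induction N with
  | zero => simp [qPochhammer]
  | succ N ih =>
    rw [mul_add, mul_one]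
    simp only [prod_range_succ, qPochhammer_succ, ih]
    ring

lemma exists_coeff_tprod_mul_tprod_eq (R : Type*) [CommRing R] [TopologicalSpace R]
    [DiscreteTopology R] [IsTopologicalRing R] (n : ℕ) : ∃ N, 2 * n ≤ N ∧
    coeff n ((∏' i, (1 - X ^ (i + 1))) * ∏' i, (1 - X ^ ((i + 1) * 5)) : R⟦X⟧) =
    coeff n ((∏ i ∈ range (5 * N), (1 - X ^ (i + 1))) * qPochhammer (X ^ 5) N : R⟦X⟧) := by
  have h1 := (multipliable_one_sub_X_pow R).hasProd.tendsto_prod_nat.comp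
    (Filter.tendsto_id.const_mul_atTop' (show 0 < 5 by norm_num))
  have h5 := (multipliable_one_sub_X_pow_mul R (t := 5) (by norm_num)).hasProd.tendsto_prod_nat
  have h := (tendsto_iff_coeff_tendsto _ _ _ _).mp (h1.mul h5) n
  rw [nhds_discrete, Filter.tendsto_pure] at h
  obtain ⟨N, hN, hN'⟩ := ((Filter.eventually_ge_atTop (2 * n)).and h).exists
  refine ⟨N, hN, ?_⟩
  rw [← hN']
  simp only [qPochhammer, Function.comp, id, ← pow_mul, mul_comm _ 5]

variable (R : Type*) [CommRing R] [NoZeroDivisors R] [TopologicalSpace R] [T2Space R]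
  [IsTopologicalRing R]

lemma mk_regularPartitionCount_mul_tprod {t : ℕ} (ht : 0 < t) :
    (PowerSeries.mk fun n ↦ (regularPartitionCount t n : R)) * ∏' i, (1 - X ^ (i + 1)) =
      ∏' i, (1 - X ^ ((i + 1) * t)) := by
  nontriviality R
  simp_rw [regularPartitionCount_eq_card_restricted]
  rw [powerSeriesMk_card_restricted_eq_tprod R (¬ t ∣ ·),
    ← (multipliable_powerSeriesMk_card_restricted R (¬ t ∣ ·)).tprod_mul
      (multipliable_one_sub_X_pow _)]
  simp_rw [ite_not, ite_mul, pow_mul]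
  conv in fun b ↦ _ =>
    ext b
    rw [tsum_pow_mul_one_sub_of_constantCoeff_eq_zero (by simp)]
  refine tprod_eq_tprod_of_ne_one_bij (fun i ↦ (i.val + 1) * t - 1) ?_ ?_ ?_
  · intro a b h
    rw [tsub_left_inj (by nlinarith) (by nlinarith), mul_left_inj' ht.ne', add_left_inj] at h
    exact SetCoe.ext h
  · suffices ∀ (i : ℕ), t ∣ i + 1 → ∃ j ≠ 0, j * t - 1 = i by simpa
    intro i hi
    obtain ⟨j, hj⟩ := dvd_def.mp hi
    refine ⟨j, by grind, Nat.sub_eq_of_eq_add ?_⟩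
    rw [hj, mul_comm t j]
  · intro i
    have : (i + 1) * t - 1 + 1 = (i + 1) * t := by grind
    simp [this, pow_mul]

lemma mk_B_three_five_eq [CharP R 3] :
    (PowerSeries.mk fun n ↦ (B 3 5 n : R)) =
      (∏' i, (1 - X ^ (i + 1))) * ∏' i, (1 - X ^ ((i + 1) * 5)) := by
  have : Nontrivial R := CharP.nontrivial_of_char_ne_one (v := 3) (by norm_num)
  have hthree : (3 : R⟦X⟧) = 0 := by
    rw [← map_ofNat (C (R := R)) 3, ← Nat.cast_ofNat, CharP.cast_eq_zero, map_zero]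
  have hfrob : (∏' i, (1 - X ^ ((i + 1) * 3)) : R⟦X⟧) = (∏' i, (1 - X ^ (i + 1))) ^ 3 := by
    rw [← (multipliable_one_sub_X_pow R).tprod_pow 3]
    refine tprod_congr fun i ↦ ?_
    rw [pow_mul]
    linear_combination (X ^ (i + 1) - (X ^ (i + 1)) ^ 2) * hthree
  have h0 := tprod_one_sub_X_pow_ne_zero R
  apply mul_right_cancel₀ (pow_ne_zero 2 h0)
  have h3 := mk_regularPartitionCount_mul_tprod R (t := 3) (by norm_num)
  have h5 := mk_regularPartitionCount_mul_tprod R (t := 5) (by norm_num)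
  rw [hfrob] at h3
  rw [mk_B_eq_mul, ← h5]
  linear_combination (PowerSeries.mk fun n ↦ (regularPartitionCount 5 n : R)) *
    (∏' i, (1 - X ^ (i + 1))) * h3

end Generating

lemma exists_sq_add_sq_of_B_three_five {n : ℕ} (h : ¬ B 3 5 n ≡ 0 [MOD 3]) :
    ∃ x y : ℕ, 10 * (4 * n + 1) = x ^ 2 + y ^ 2 := by
  let _ : TopologicalSpace (ZMod 3) := ⊥
  have _ : DiscreteTopology (ZMod 3) := ⟨rfl⟩
  have h0 : coeff n (PowerSeries.mk fun n ↦ (B 3 5 n : ZMod 3)) ≠ 0 := by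
    rwa [coeff_mk, ← Nat.cast_zero, Ne, ZMod.natCast_eq_natCast_iff]
  obtain ⟨N, hN, hcoeff⟩ := exists_coeff_tprod_mul_tprod_eq (ZMod 3) n
  rw [mk_B_three_five_eq, hcoeff, prod_range_five_mul, mul_assoc, mul_mul_mul_comm, coeff_mul] at h0
  obtain ⟨⟨a, b⟩, hab, hne⟩ := exists_ne_zero_of_sum_ne_zero h0
  rw [HasAntidiagonal.mem_antidiagonal] at hab
  obtain ⟨x, hx⟩ := exists_of_coeff_tripleProduct_ne_zero (by norm_num) (by norm_num)
    (by omega) (left_ne_zero_of_mul hne)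
  obtain ⟨y, hy⟩ := exists_of_coeff_tripleProduct_ne_zero (by norm_num) (by norm_num)
    (by omega) (right_ne_zero_of_mul hne)
  refine ⟨(10 * x + 3).natAbs, (10 * y + 1).natAbs, ?_⟩
  zify
  rw [sq_abs, sq_abs, ← hab]
  push_cast at hx hy ⊢
  linear_combination 20 * hx + 20 * hy

lemma B_three_five_modEq_zero {q A : ℕ} (hq : q.Prime) (hq4 : q % 4 = 3) (hA : Odd A) {j : ℕ}
    (hj : ¬ q ∣ j) (n : ℕ) :
    B 3 5 (A ^ 2 * q ^ 2 * n + (A ^ 2 * q * (4 * j + q) - 1) / 4) ≡ 0 [MOD 3] := by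
  have := Fact.mk hq
  have hA0 : A ≠ 0 := hA.pos.ne'
  have hmod : (A ^ 2 * q * (4 * j + q)) % 4 = 1 := by
    have hA2 : A ^ 2 % 4 = 1 := by
      obtain ⟨a, rfl⟩ := hA
      ring_nf
      omega
    have hqj : q * (4 * j + q) % 4 = 1 := by simp [Nat.mul_mod, Nat.add_mod, hq4]
    rw [mul_assoc, Nat.mul_mod, hA2, hqj]
  by_contra hne
  obtain ⟨x, y, hxy⟩ := exists_sq_add_sq_of_B_three_five hne
  have hm : 10 * (4 * (A ^ 2 * q ^ 2 * n + (A ^ 2 * q * (4 * j + q) - 1) / 4) + 1) =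
      A ^ 2 * (q * (10 * (4 * q * n + 4 * j + q))) := by
    have : 4 * ((A ^ 2 * q * (4 * j + q) - 1) / 4) + 1 = A ^ 2 * q * (4 * j + q) := by omega
    linear_combination 10 * this
  rw [hm] at hxy
  have hq10 : ¬ q ∣ 10 := by
    intro h
    have : q ≤ 10 := Nat.le_of_dvd (by norm_num) h
    interval_cases q <;> omega
  have hq4' : ¬ q ∣ 4 := by
    intro h
    have : q ≤ 4 := Nat.le_of_dvd (by norm_num) h
    interval_cases q <;> omega
  have hnd : ¬ q ∣ 10 * (4 * q * n + 4 * j + q) := by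
    rw [hq.dvd_mul, not_or, Nat.dvd_add_left dvd_rfl,
      Nat.dvd_add_right (Dvd.intro_left (4 * n) (by ring)), hq.dvd_mul]
    tauto
  have hm0 : 10 * (4 * q * n + 4 * j + q) ≠ 0 := fun h0 ↦ hnd (h0 ▸ dvd_zero q)
  have hqm0 := mul_ne_zero hq.ne_zero hm0
  have hA20 := pow_ne_zero 2 hA0
  have heven := Nat.eq_sq_add_sq_iff.mp ⟨x, y, hxy⟩ q
    (Nat.mem_primeFactors.mpr ⟨hq, (Dvd.intro _ rfl).mul_left _, mul_ne_zero hA20 hqm0⟩) hq4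
  rw [padicValNat.mul hA20 hqm0, padicValNat.mul hq.ne_zero hm0,
    padicValNat.pow, padicValNat_self, padicValNat.eq_zero_of_not_dvd hnd] at heven
  grind

end BipartitionCongruence

/-- Theorem 1.2(ii): congruences modulo 3 for `B 3 5`.  Here `p 0, …, p k` play the role of
`p_1, …, p_{k+1}` in the paper. -/
theorem B_3_5_cong (k n j : ℕ) (p : ℕ → ℕ)
    (hp : ∀ i < k + 1, (p i).Prime ∧ p i % 4 = 3)
    (hj : ¬ p k ∣ j) :
    B 3 5 ((∏ i ∈ Finset.range (k + 1), (p i) ^ 2) * n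
        + ((∏ i ∈ Finset.range k, (p i) ^ 2) * p k * (4 * j + p k) - 1) / 4)
      ≡ 0 [MOD 3] := by
  obtain ⟨hpk, hpk4⟩ := hp k (Nat.lt_succ_self k)
  rw [Finset.prod_range_succ, Finset.prod_pow]
  refine B_three_five_modEq_zero hpk hpk4 ?_ hj n
  refine Finset.prod_induction p Odd (fun _ _ ↦ Odd.mul) odd_one fun i hi ↦ ?_
  have := (hp i (Nat.lt_succ_of_lt (Finset.mem_range.mp hi))).2
  rw [Nat.odd_iff]
  omega
end

section
/- Let p be a prime number with p ≡ 1 (mod 6) and suppose B_{3,7}((p−1)/3) ≡ 0 (mod 3). Then for every nonnegative integer α and every nonnegative integer n with p ∤ (3n+1), we have B_{3,7}( p^{2α+1} n + (p^{2α+1} − 1)/3 ) ≡ 0 (mod 3). -/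
section GeneratingFunction

open PowerSeries
open scoped PowerSeries.WithPiTopology

theorem regularPartitionCount_eq_card_countRestricted_s4 {m : ℕ} (hm : 0 < m) (n : ℕ) :
    regularPartitionCount m n = (Nat.Partition.countRestricted n m).card := by
  rw [← Nat.Partition.card_restricted_eq_card_countRestricted n hm, regularPartitionCount,
    Nat.card_eq_fintype_card, Fintype.card_subtype, Nat.Partition.restricted]

variable (R : Type*) [CommRing R]

theorem hasProd_regularPartitionCount [TopologicalSpace R] [T2Space R] {m : ℕ} (hm : 0 < m) :
    HasProd (fun i ↦ ∑ j ∈ Finset.range m, X ^ ((i + 1) * j))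
      (PowerSeries.mk fun n ↦ (regularPartitionCount m n : R)) := by
  simpa only [regularPartitionCount_eq_card_countRestricted_s4 hm] using
    Nat.Partition.hasProd_powerSeriesMk_card_countRestricted R hm

theorem hasProd_one_sub_X_pow_mul [TopologicalSpace R] {m : ℕ} (hm : m ≠ 0) :
    HasProd (fun i ↦ (1 - X ^ ((i + 1) * m) : R⟦X⟧)) (expand m hm (pentagonalSeries R)) := by
  have hc : Continuous (expand m hm (R := R)) := by
    refine continuous_iff_continuousAt.2 fun f ↦
      (WithPiTopology.tendsto_iff_coeff_tendsto R _ _ _).2 fun d ↦ ?_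
    by_cases hd : m ∣ d
    · obtain ⟨d, rfl⟩ := hd
      simp only [coeff_expand_mul]
      exact (WithPiTopology.continuous_coeff R d).continuousAt
    · simp only [coeff_expand_of_not_dvd _ _ _ hd]
      exact tendsto_const_nhds
  have := (WithPiTopology.hasProd_one_sub_X_pow R).map (expand m hm) hc
  convert this using 2 with i
  simp [← pow_mul, mul_comm]

/-- The generating function of `m`-regular partitions times Euler's product `∏ (1 - X ^ i)` is
`∏ (1 - X ^ (m * i))`. -/
theorem mk_regularPartitionCount_mul_pentagonalSeries {m : ℕ} (hm : m ≠ 0) :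
    PowerSeries.mk (fun n ↦ (regularPartitionCount m n : R)) * pentagonalSeries R =
      expand m hm (pentagonalSeries R) := by
  let _ : TopologicalSpace R := ⊥
  have _ : DiscreteTopology R := ⟨rfl⟩
  have h := (hasProd_regularPartitionCount R (Nat.pos_of_ne_zero hm)).mul
    (WithPiTopology.hasProd_one_sub_X_pow R)
  refine h.unique ?_
  convert hasProd_one_sub_X_pow_mul R hm using 2 with i
  simp only [pow_mul]
  exact geom_sum_mul_neg _ _

theorem mk_regularPartitionCount_three [CharP R 3] :
    PowerSeries.mk (fun n ↦ (regularPartitionCount 3 n : R)) = pentagonalSeries R ^ 2 := by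
  let _ : TopologicalSpace R := ⊥
  have _ : DiscreteTopology R := ⟨rfl⟩
  have h := (WithPiTopology.hasProd_one_sub_X_pow R).mul (WithPiTopology.hasProd_one_sub_X_pow R)
  rw [sq]
  refine (hasProd_regularPartitionCount R three_pos).unique ?_
  have h3 : (3 : R⟦X⟧) = 0 := by
    rw [← map_ofNat (C (R := R)) 3, show (OfNat.ofNat 3 : R) = 0 from CharP.cast_eq_zero R 3,
      map_zero]
  have hfactor (i : ℕ) : ∑ j ∈ Finset.range 3, (X : R⟦X⟧) ^ ((i + 1) * j) =
      (1 - X ^ (i + 1)) * (1 - X ^ (i + 1)) := by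
    rw [Finset.sum_range_succ, Finset.sum_range_succ, Finset.sum_range_one]
    linear_combination X ^ (i + 1) * h3
  convert h using 2 with i
  exact hfactor i

theorem B_three_seven_cast [CharP R 3] (n : ℕ) :
    (B 3 7 n : R) = coeff n (pentagonalSeries R * expand 7 (by norm_num) (pentagonalSeries R)) := by
  rw [← mk_regularPartitionCount_mul_pentagonalSeries R (m := 7) (by norm_num),
    ← mul_assoc, mul_right_comm, ← sq, ← mk_regularPartitionCount_three R, coeff_mul,
    Finset.Nat.sum_antidiagonal_eq_sum_range_succ_mk, B]
  simp

theorem coeff_pentagonalSeries_mul_expand (n : ℕ) {m : ℕ} (hm : m ≠ 0)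
    (s : Finset (ℤ × ℤ)) (hs : ∀ k l, (k, l) ∈ s ↔ pentagonal k + m * pentagonal l = n) :
    coeff n (pentagonalSeries R * expand m hm (pentagonalSeries R)) =
      ∑ kl ∈ s, ((Int.negOnePow (kl.1 + kl.2) : ℤ) : R) := by
  rw [coeff_mul]
  symm
  refine Finset.sum_of_injOn (fun kl ↦ (pentagonal kl.1, m * pentagonal kl.2)) ?_ ?_ ?_ ?_
  · rintro ⟨a, b⟩ _ ⟨c, d⟩ _ h
    simpa [hm] using h
  · rintro ⟨a, b⟩ h
    simpa [hs] using h
  · rintro ⟨i, j⟩ hij hne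
    replace hij := Finset.HasAntidiagonal.mem_antidiagonal.1 hij
    by_contra h0
    obtain ⟨h1, h2⟩ := ne_zero_and_ne_zero_of_mul h0
    obtain ⟨j, rfl⟩ : m ∣ j := by
      by_contra hd
      exact h2 (coeff_expand_of_not_dvd _ _ _ hd)
    rw [coeff_expand_mul] at h2
    obtain ⟨k, rfl⟩ : i ∈ Set.range pentagonal := by
      by_contra hd
      exact h1 (coeff_pentagonalSeries_eq_zero R hd)
    obtain ⟨l, rfl⟩ : j ∈ Set.range pentagonal := by
      by_contra hd
      exact h2 (coeff_pentagonalSeries_eq_zero R hd)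
    exact hne ⟨(k, l), by simpa [hs] using hij, rfl⟩
  · rintro ⟨k, l⟩ _
    simp [coeff_expand_mul, Int.negOnePow_add]

end GeneratingFunction

section Arithmetic

theorem exists_sq_add_seven_mul_sq_eq_mul {p : ℕ} (hp : p.Prime) (h : IsSquare (-7 : ZMod p)) :
    ∃ x y k : ℤ, 0 < k ∧ k < 8 ∧ x ^ 2 + 7 * y ^ 2 = k * p := by
  have : Fact p.Prime := ⟨hp⟩
  obtain ⟨t, ht⟩ := h
  set s := p.sqrt
  have hs : s ^ 2 < p := by
    refine lt_of_le_of_ne (Nat.sqrt_le' p) fun h ↦ ?_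
    exact hp.prime.not_isSquare ⟨s, by rw [← h, sq]⟩
  let f : ℕ × ℕ → ZMod p := fun a ↦ a.1 - t * a.2
  have hcard : (Finset.univ : Finset (ZMod p)).card <
      (Finset.range (s + 1) ×ˢ Finset.range (s + 1)).card := by
    rw [Finset.card_univ, ZMod.card, Finset.card_product, Finset.card_range]
    exact Nat.lt_succ_sqrt p
  obtain ⟨⟨a, b⟩, hab, ⟨c, d⟩, hcd, hne, heq⟩ :=
    Finset.exists_ne_map_eq_of_card_lt_of_maps_to hcard (f := f) (fun _ _ ↦ Finset.mem_univ _)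
  simp only [Finset.mem_product, Finset.mem_range, f] at hab hcd heq
  have hdvd : (p : ℤ) ∣ ((a : ℤ) - c) ^ 2 + 7 * ((b : ℤ) - d) ^ 2 := by
    rw [← ZMod.intCast_zmod_eq_zero_iff_dvd]
    push_cast
    have h1 : (a : ZMod p) - c = t * (b - d) := by linear_combination heq
    rw [h1]
    linear_combination -((b : ZMod p) - d) ^ 2 * ht
  obtain ⟨k, hk⟩ := hdvd
  have hp0 : (0 : ℤ) < p := by exact_mod_cast hp.pos
  have hx : ((a : ℤ) - c) ^ 2 ≤ (s : ℤ) ^ 2 := sq_le_sq' (by omega) (by omega)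
  have hy : ((b : ℤ) - d) ^ 2 ≤ (s : ℤ) ^ 2 := sq_le_sq' (by omega) (by omega)
  have hs' : (s : ℤ) ^ 2 < p := by exact_mod_cast hs
  refine ⟨a - c, b - d, k, ?_, ?_, by rw [hk, mul_comm]⟩
  · have : 0 < ((a : ℤ) - c) ^ 2 + 7 * ((b : ℤ) - d) ^ 2 := by
      by_cases hac : (a : ℤ) - c = 0
      · have hbd : (b : ℤ) - d ≠ 0 := fun h ↦ hne (by ext <;> simp <;> omega)
        positivity
      · positivity
    rw [hk] at this
    exact pos_of_mul_pos_right this hp0.le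
  · nlinarith

theorem exists_eq_sq_add_seven_mul_sq {p : ℕ} (hp : p.Prime) (hp1 : p % 6 = 1)
    (h : IsSquare (-7 : ZMod p)) : ∃ x y : ℤ, x ^ 2 + 7 * y ^ 2 = p := by
  obtain ⟨x, y, k, hk0, hk8, hxy⟩ := exists_sq_add_seven_mul_sq_eq_mul hp h
  have hndvd (q : ℕ) (hq : q.Prime) (hq5 : q ≤ 5) : ¬ (q : ℤ) ∣ p := by
    intro h
    obtain rfl := (Nat.prime_dvd_prime_iff_eq hq hp).1 (by exact_mod_cast h)
    interval_cases q <;> first | omega | exact absurd hq (by norm_num)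
  have h2 := hndvd 2 Nat.prime_two (by norm_num)
  have h3 := hndvd 3 Nat.prime_three (by norm_num)
  have h5 := hndvd 5 Nat.prime_five (by norm_num)
  push_cast at h2 h3 h5
  have even (h : 2 ∣ k) : ∃ a b, x = 2 * a ∧ y = 2 * b := by
    refine ⟨x / 2, y / 2, ?_⟩
    obtain ⟨a, ha⟩ : ∃ a, a = x / 2 := ⟨_, rfl⟩
    obtain ⟨b, hb⟩ : ∃ b, b = y / 2 := ⟨_, rfl⟩
    obtain ⟨c, hc⟩ := Int.even_mul_succ_self a
    obtain ⟨d, hd⟩ := Int.even_mul_succ_self b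
    have hx : x = 2 * a ∨ x = 2 * a + 1 := by omega
    have hy : y = 2 * b ∨ y = 2 * b + 1 := by omega
    rw [← ha, ← hb]
    rcases hx with rfl | rfl <;> rcases hy with rfl | rfl <;> ring_nf at hxy hc hd <;>
      interval_cases k <;> omega
  interval_cases k
  · exact ⟨x, y, by linarith⟩
  · obtain ⟨a, b, rfl, rfl⟩ := even (by norm_num)
    exact absurd ⟨a ^ 2 + 7 * b ^ 2, by linarith⟩ h2
  · exfalso
    obtain ⟨a, ha⟩ : ∃ a, x = 3 * a ∨ x = 3 * a + 1 ∨ x = 3 * a + 2 := ⟨x / 3, by omega⟩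
    obtain ⟨b, hb⟩ : ∃ b, y = 3 * b ∨ y = 3 * b + 1 ∨ y = 3 * b + 2 := ⟨y / 3, by omega⟩
    rcases ha with rfl | rfl | rfl <;> rcases hb with rfl | rfl | rfl <;> ring_nf at hxy <;> omega
  · obtain ⟨a, b, rfl, rfl⟩ := even (by norm_num)
    exact ⟨a, b, by linarith⟩
  · exfalso
    obtain ⟨a, ha⟩ : ∃ a, x = 5 * a ∨ x = 5 * a + 1 ∨ x = 5 * a + 2 ∨ x = 5 * a + 3 ∨
      x = 5 * a + 4 := ⟨x / 5, by omega⟩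
    obtain ⟨b, hb⟩ : ∃ b, y = 5 * b ∨ y = 5 * b + 1 ∨ y = 5 * b + 2 ∨ y = 5 * b + 3 ∨
      y = 5 * b + 4 := ⟨y / 5, by omega⟩
    rcases ha with rfl | rfl | rfl | rfl | rfl <;> rcases hb with rfl | rfl | rfl | rfl | rfl <;>
      ring_nf at hxy <;> omega
  · obtain ⟨a, b, rfl, rfl⟩ := even (by norm_num)
    exact absurd ⟨a ^ 2 + 7 * b ^ 2 - p, by linarith⟩ h2
  · have hx7 : (7 : ℤ) ∣ x := (show Prime (7 : ℤ) by norm_num).dvd_of_dvd_pow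
      (n := 2) ⟨p - y ^ 2, by linarith⟩
    obtain ⟨a, rfl⟩ := hx7
    exact ⟨y, a, by linarith⟩

theorem eq_of_sq_add_seven_mul_sq_eq {p : ℕ} (hp : p.Prime) {x y r s : ℤ}
    (hxy : x ^ 2 + 7 * y ^ 2 = p) (hrs : r ^ 2 + 7 * s ^ 2 = 8 * p) :
    ∃ A B : ℤ, (A = 1 ∨ A = -1) ∧ (B = 1 ∨ B = -1) ∧
      ((r = x * A + 7 * y * B ∧ s = y * A - x * B) ∨
        (r = x * A - 7 * y * B ∧ s = -y * A - x * B)) := by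
  have hpp : Prime (p : ℤ) := Nat.prime_iff_prime_int.1 hp
  have key (y : ℤ) (hxy : x ^ 2 + 7 * y ^ 2 = p) (hd : (p : ℤ) ∣ r * y - s * x) :
      ∃ A B : ℤ, (A = 1 ∨ A = -1) ∧ (B = 1 ∨ B = -1) ∧
        r = x * A + 7 * y * B ∧ s = y * A - x * B := by
    obtain ⟨B, hB⟩ := hd
    have h1 : (r * x + 7 * s * y) ^ 2 = p * (p * (8 - 7 * B ^ 2)) := by
      have : (r * x + 7 * s * y) ^ 2 + 7 * (r * y - s * x) ^ 2 = 8 * p * p := by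
        rw [← hrs, ← hxy]; ring
      rw [hB] at this
      linear_combination this
    obtain ⟨A, hA⟩ := hpp.dvd_of_dvd_pow (Dvd.intro _ h1.symm)
    have hp0 : (p : ℤ) ≠ 0 := hpp.ne_zero
    have hAB : A ^ 2 + 7 * B ^ 2 = 8 := by
      rw [hA] at h1
      apply mul_left_cancel₀ (pow_ne_zero 2 hp0)
      linear_combination h1
    have hr : r = x * A + 7 * y * B := by
      apply mul_left_cancel₀ hp0
      linear_combination x * hA + 7 * y * hB - r * hxy
    have hs : s = y * A - x * B := by
      apply mul_left_cancel₀ hp0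
      linear_combination y * hA - x * hB - s * hxy
    have hB2 : B ^ 2 = 1 := by
      have h1 : B ≤ 1 := by nlinarith
      have h2 : -1 ≤ B := by nlinarith
      interval_cases B
      · norm_num
      · have h1 : A ≤ 2 := by nlinarith
        have h2 : -2 ≤ A := by nlinarith
        interval_cases A <;> omega
      · norm_num
    exact ⟨A, B, sq_eq_one_iff.1 (by omega), sq_eq_one_iff.1 hB2, hr, hs⟩
  have hd : (p : ℤ) ∣ (r * y - s * x) * (r * y + s * x) :=
    ⟨8 * y ^ 2 - s ^ 2, by linear_combination y ^ 2 * hrs - s ^ 2 * hxy⟩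
  rcases hpp.dvd_or_dvd hd with h | h
  · obtain ⟨A, B, hA, hB, h1, h2⟩ := key y hxy h
    exact ⟨A, B, hA, hB, .inl ⟨h1, h2⟩⟩
  · obtain ⟨A, B, hA, hB, h1, h2⟩ := key (-y) (by rw [← hxy]; ring)
      (by rw [← dvd_neg]; convert h using 1; ring)
    exact ⟨A, B, hA, hB, .inr ⟨by rw [h1]; ring, h2⟩⟩

theorem dvd_and_dvd_of_dvd_sq_add_seven_mul_sq {p : ℕ} [Fact p.Prime]
    (h : ¬ IsSquare (-7 : ZMod p)) {r s : ℤ} (hd : (p : ℤ) ∣ r ^ 2 + 7 * s ^ 2) :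
    (p : ℤ) ∣ r ∧ (p : ℤ) ∣ s := by
  simp only [← ZMod.intCast_zmod_eq_zero_iff_dvd] at hd ⊢
  push_cast at hd
  have hs : (s : ZMod p) = 0 := by
    by_contra hs
    refine h ⟨r / s, ?_⟩
    field_simp
    linear_combination -hd
  refine ⟨?_, hs⟩
  simpa [hs] using hd

theorem sq_add_seven_mul_sq_ne {p : ℕ} [Fact p.Prime] (h : ¬ IsSquare (-7 : ZMod p)) {N : ℤ}
    (hN : ¬ (p : ℤ) ∣ N) (a : ℕ) (r s : ℤ) : r ^ 2 + 7 * s ^ 2 ≠ p ^ (2 * a + 1) * N := by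
  have hp0 : (p : ℤ) ≠ 0 := by exact_mod_cast (Fact.out : p.Prime).ne_zero
  induction a generalizing r s with
  | zero =>
    intro hrs
    obtain ⟨⟨r, rfl⟩, ⟨s, rfl⟩⟩ := dvd_and_dvd_of_dvd_sq_add_seven_mul_sq h (r := r) (s := s)
      ⟨N, by simpa using hrs⟩
    refine hN ⟨r ^ 2 + 7 * s ^ 2, ?_⟩
    apply mul_left_cancel₀ hp0
    linear_combination -hrs
  | succ a ih =>
    intro hrs
    obtain ⟨⟨r, rfl⟩, ⟨s, rfl⟩⟩ := dvd_and_dvd_of_dvd_sq_add_seven_mul_sq h (r := r) (s := s)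
      ⟨p ^ (2 * a + 2) * N, by rw [hrs]; ring⟩
    refine ih r s ?_
    apply mul_left_cancel₀ (pow_ne_zero 2 hp0)
    linear_combination hrs

end Arithmetic

theorem pentagonal_add_seven_mul_pentagonal_eq_iff (k l : ℤ) (n : ℕ) :
    pentagonal k + 7 * pentagonal l = n ↔
      (6 * k - 1) ^ 2 + 7 * (6 * l - 1) ^ 2 = 8 * (3 * n + 1 : ℤ) := by
  have hk := two_mul_natCast_pentagonal k
  have hl := two_mul_natCast_pentagonal l
  rw [← Nat.cast_inj (R := ℤ)]
  push_cast
  constructor <;> intro h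
  · linear_combination 24 * h - 12 * hk - 84 * hl
  · have : (24 : ℤ) * (pentagonal k + 7 * pentagonal l) = 24 * n := by
      linear_combination h + 12 * hk + 84 * hl
    omega

theorem B_three_seven_eq_zero {n : ℕ}
    (h : ∀ r s : ℤ, r ^ 2 + 7 * s ^ 2 ≠ 8 * (3 * n + 1 : ℤ)) : (B 3 7 n : ZMod 3) = 0 := by
  rw [B_three_seven_cast, coeff_pentagonalSeries_mul_expand _ _ _ ∅, Finset.sum_empty]
  intro k l
  simp [pentagonal_add_seven_mul_pentagonal_eq_iff, h]

theorem exists_pentagonal_representations {p : ℕ} (hp : p.Prime) (hp1 : p % 6 = 1)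
    {x y : ℤ} (hxy : x ^ 2 + 7 * y ^ 2 = p) :
    ∃ k₁ l₁ k₂ l₂ : ℤ, Int.negOnePow (k₂ + l₂) = Int.negOnePow (k₁ + l₁) ∧ ∀ k l : ℤ,
      (k = k₁ ∧ l = l₁ ∨ k = k₂ ∧ l = l₂) ↔
        (6 * k - 1) ^ 2 + 7 * (6 * l - 1) ^ 2 = 8 * (p : ℤ) := by
  have hres : ((x + y) % 6 = 1 ∨ (x + y) % 6 = 5) ∧ ((x - y) % 6 = 1 ∨ (x - y) % 6 = 5) := by
    obtain ⟨a, ha⟩ : ∃ a, a = x / 6 := ⟨_, rfl⟩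
    obtain ⟨b, hb⟩ : ∃ b, b = y / 6 := ⟨_, rfl⟩
    have hx : x = 6 * a ∨ x = 6 * a + 1 ∨ x = 6 * a + 2 ∨ x = 6 * a + 3 ∨ x = 6 * a + 4 ∨
      x = 6 * a + 5 := by omega
    have hy : y = 6 * b ∨ y = 6 * b + 1 ∨ y = 6 * b + 2 ∨ y = 6 * b + 3 ∨ y = 6 * b + 4 ∨
      y = 6 * b + 5 := by omega
    clear ha hb
    rcases hx with rfl | rfl | rfl | rfl | rfl | rfl <;>
      rcases hy with rfl | rfl | rfl | rfl | rfl | rfl <;> ring_nf at hxy <;> omega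
  obtain ⟨e, he, l₁, h1⟩ : ∃ e : ℤ, (e = 1 ∨ e = -1) ∧ ∃ l, e * (x + y) = 6 * l - 1 := by
    rcases hres.1 with h | h
    · exact ⟨-1, by simp, (-1 * (x + y) + 1) / 6, by omega⟩
    · exact ⟨1, by simp, (1 * (x + y) + 1) / 6, by omega⟩
  obtain ⟨e', he', l₂, h2⟩ : ∃ e : ℤ, (e = 1 ∨ e = -1) ∧ ∃ l, e * (x - y) = 6 * l - 1 := by
    rcases hres.2 with h | h
    · exact ⟨-1, by simp, (-1 * (x - y) + 1) / 6, by omega⟩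
    · exact ⟨1, by simp, (1 * (x - y) + 1) / 6, by omega⟩
  refine ⟨l₂ - e' * y, l₁, l₁ + e * y, l₂, ?_, fun k l ↦ ⟨?_, fun h ↦ ?_⟩⟩
  · rw [Int.negOnePow_eq_iff]
    rcases he with rfl | rfl <;> rcases he' with rfl | rfl <;> grind
  · have he2 : e ^ 2 = 1 := by rcases he with rfl | rfl <;> norm_num
    have he2' : e' ^ 2 = 1 := by rcases he' with rfl | rfl <;> norm_num
    rintro (⟨rfl, rfl⟩ | ⟨rfl, rfl⟩)
    · rw [show 6 * (l₂ - e' * y) - 1 = e' * (x - 7 * y) by linear_combination -h2, ← h1, mul_pow,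
        mul_pow, he2, he2']
      linear_combination 8 * hxy
    · rw [show 6 * (l₁ + e * y) - 1 = e * (x + 7 * y) by linear_combination -h1, ← h2, mul_pow,
        mul_pow, he2, he2']
      linear_combination 8 * hxy
  · obtain ⟨a, b, ha, hb, h⟩ := eq_of_sq_add_seven_mul_sq_eq hp hxy h
    rcases he with rfl | rfl <;> rcases he' with rfl | rfl <;> rcases ha with rfl | rfl <;>
      rcases hb with rfl | rfl <;> omega

theorem B_three_seven_ne_zero {p : ℕ} (hp : p.Prime) (hp1 : p % 6 = 1)
    (h : IsSquare (-7 : ZMod p)) : (B 3 7 ((p - 1) / 3) : ZMod 3) ≠ 0 := by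
  obtain ⟨x, y, hxy⟩ := exists_eq_sq_add_seven_mul_sq hp hp1 h
  obtain ⟨k₁, l₁, k₂, l₂, hsign, hiff⟩ := exists_pentagonal_representations hp hp1 hxy
  have hn : (3 * ((p - 1) / 3 : ℕ) + 1 : ℤ) = p := by omega
  rw [B_three_seven_cast, coeff_pentagonalSeries_mul_expand _ _ _ {(k₁, l₁), (k₂, l₂)}]
  · have hunit : ∀ u : ℤˣ, ((u : ℤ) : ZMod 3) ≠ 0 ∧
        ((u : ℤ) : ZMod 3) + ((u : ℤ) : ZMod 3) ≠ 0 := by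
      decide
    by_cases heq : (k₁, l₁) = (k₂, l₂)
    · rw [heq, Finset.pair_eq_singleton, Finset.sum_singleton]
      exact (hunit _).1
    · rw [Finset.sum_pair heq, hsign]
      exact (hunit _).2
  · intro k l
    rw [pentagonal_add_seven_mul_pentagonal_eq_iff, hn, ← hiff]
    simp

/-- Theorem 1.4(i). -/
theorem B_3_7_newman_cong (p : ℕ) (hp : p.Prime) (hp1 : p % 6 = 1)
    (hB : B 3 7 ((p - 1) / 3) ≡ 0 [MOD 3]) (α n : ℕ) (hn : ¬ p ∣ (3 * n + 1)) :
    B 3 7 (p ^ (2 * α + 1) * n + (p ^ (2 * α + 1) - 1) / 3) ≡ 0 [MOD 3] := by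
  have : Fact p.Prime := ⟨hp⟩
  rw [← ZMod.natCast_eq_natCast_iff, Nat.cast_zero] at hB ⊢
  have hsq : ¬ IsSquare (-7 : ZMod p) := fun h ↦ B_three_seven_ne_zero hp hp1 h hB
  refine B_three_seven_eq_zero fun r s ↦ ?_
  have hq : p ^ (2 * α + 1) % 3 = 1 := by
    rw [Nat.pow_mod, show p % 3 = 1 by omega, one_pow, Nat.one_mod]
  have hN : ¬ (p : ℤ) ∣ 8 * (3 * n + 1) := by
    intro h
    have h' : p ∣ 8 * (3 * n + 1) := by exact_mod_cast h
    rcases hp.dvd_mul.1 h' with h8 | h8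
    · have := (Nat.prime_dvd_prime_iff_eq hp Nat.prime_two).1
        (hp.dvd_of_dvd_pow (show p ∣ 2 ^ 3 from h8))
      omega
    · exact hn h8
  convert sq_add_seven_mul_sq_ne hsq hN α r s using 1
  have h3 : (3 * ((p ^ (2 * α + 1) - 1) / 3 : ℕ) : ℤ) = p ^ (2 * α + 1) - 1 := by
    rw [← Nat.cast_pow]
    omega
  push_cast at h3 ⊢
  linear_combination 8 * h3
end
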